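/- Fix an integer k ≥ 0 and γ > 0. There exists q = q(k) > 0 such that for every M > 0 there is a constant C = C(k, γ, M) > 0 with the following property: for every smooth mean-zero 2π-periodic forcing f with ‖f‖_{H^k} ≤ M and every smooth solution u of the damped–driven KdV equation with damping γ and forcing f, one has for all t ≥ 0: ‖u(t,·)‖_{H^k} ≤ C ( e^{−γ t} ( ‖u(0,·)‖_{H^k} + ‖u(0,·)‖_{L²}^{q} ) + 1 ). -/

import Mathlib

open MeasureTheory Real Filter

noncomputable section

/-- A smooth, mean-zero, `2π`-periodic function `v : ℝ → ℝ`. -/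
def SmoothMeanZeroPeriodic (v : ℝ → ℝ) : Prop :=
  ContDiff ℝ (⊤ : ℕ∞) v ∧ (∀ x : ℝ, v (x + 2 * Real.pi) = v x) ∧
    (∫ x in (0:ℝ)..(2 * Real.pi), v x) = 0

/-- The `L²` norm over one period: `(∫₀^{2π} |v|²)^{1/2}`. -/
def L2norm (v : ℝ → ℝ) : ℝ := Real.sqrt (∫ x in (0:ℝ)..(2 * Real.pi), (v x) ^ 2)

/-- The homogeneous Sobolev norm `‖v‖_{H^m} = ‖D^m v‖_{L²}`. -/
def Hnorm (m : ℕ) (v : ℝ → ℝ) : ℝ := L2norm (iteratedDeriv m v)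

/-- A smooth solution of the damped–driven KdV equation
`∂ₜu + u ∂ₓu + ∂ₓ³u + γu = f` on `[0,∞) × ℝ`, mean-zero `2π`-periodic in `x`. -/
def IsDampedKdVSol (γ : ℝ) (f : ℝ → ℝ) (u : ℝ → ℝ → ℝ) : Prop :=
  ContDiff ℝ (⊤ : ℕ∞) (fun p : ℝ × ℝ => u p.1 p.2) ∧
  (∀ t : ℝ, 0 ≤ t → SmoothMeanZeroPeriodic (u t)) ∧
  (∀ t x : ℝ, 0 ≤ t →
    deriv (fun s => u s x) t + u t x * deriv (u t) x + iteratedDeriv 3 (u t) x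
      + γ * u t x = f x)

section Formal

open MvPolynomial

/-- Polynomials in `X₀, X₁, …` all of whose monomials have degree at least `j` and weight `N`,
where `Xᵢ` has weight `i + 2`. -/
def graded (j N : ℕ) : Submodule ℝ (MvPolynomial ℕ ℝ) :=
  restrictSupport ℝ {d | j ≤ d.degree ∧ Finsupp.weight (fun i : ℕ => i + 2) d = N}

/-- Polynomials all of whose monomials have degree at least `j`, weight `N`, and only involve
the variables `Xᵢ` with `i < k`. -/
def gradedBelow (k j N : ℕ) : Submodule ℝ (MvPolynomial ℕ ℝ) :=
  restrictSupport ℝ {d | j ≤ d.degree ∧ Finsupp.weight (fun i : ℕ => i + 2) d = N ∧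
    ∀ i ∈ d.support, i < k}

/-- The quadratic part of the Gardner recursion. -/
def gardnerQuad {S : Type*} [CommRing S] [Algebra ℝ S] (w : ℕ → S) (n : ℕ) : S :=
  (1 / 6 : ℝ) • ∑ i ∈ Finset.range n, w i * w (n - 1 - i)

/-- The derivation `X_n ↦ -X_{n+1} + (1/6) ∑_{i+j=n-1} X_i X_j`, modelling `d/dx` acting on the
Gardner densities. -/
def gardnerD : Derivation ℝ (MvPolynomial ℕ ℝ) (MvPolynomial ℕ ℝ) :=
  mkDerivation ℝ fun n => -X (n + 1) + gardnerQuad X n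

lemma gardnerD_X (n : ℕ) : gardnerD (X n) = -X (n + 1) + gardnerQuad X n :=
  mkDerivation_X _ _ _

lemma graded_mono {j j' N : ℕ} (h : j' ≤ j) : graded j N ≤ graded j' N :=
  restrictSupport_mono ℝ fun _ hd => ⟨h.trans hd.1, hd.2⟩

lemma mul_mem_graded {j j' N N' : ℕ} {P Q : MvPolynomial ℕ ℝ} (hP : P ∈ graded j N)
    (hQ : Q ∈ graded j' N') : P * Q ∈ graded (j + j') (N + N') := by
  refine restrictSupport_mono ℝ ?_
    (restrictSupport_add (R := ℝ) _ _ ▸ Submodule.mul_mem_mul hP hQ)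
  rintro _ ⟨d, hd, e, he, rfl⟩
  simp only [Set.mem_ofPred_eq] at hd he ⊢
  simp only [map_add]
  omega

lemma X_mem_graded (i : ℕ) : (X i : MvPolynomial ℕ ℝ) ∈ graded 1 (i + 2) := by
  refine (monomial_mem_restrictSupport (R := ℝ)).2 (Or.inl ?_)
  simp [Finsupp.weight_single]

lemma gardnerQuad_X_mem_graded (n : ℕ) :
    gardnerQuad (X : ℕ → MvPolynomial ℕ ℝ) n ∈ graded 2 (n + 3) := by
  refine Submodule.smul_mem _ _ (Submodule.sum_mem _ fun i hi => ?_)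
  have hi := Finset.mem_range.1 hi
  have := mul_mem_graded (X_mem_graded i) (X_mem_graded (n - 1 - i))
  convert this using 2
  omega

lemma gardnerD_mem_graded {j N : ℕ} {P : MvPolynomial ℕ ℝ} (hP : P ∈ graded j N) :
    gardnerD P ∈ graded j (N + 1) := by
  rw [graded, restrictSupport_eq_span] at hP
  induction hP using Submodule.span_induction with
  | zero => simp
  | add P Q _ _ hP hQ => rw [map_add]; exact Submodule.add_mem _ hP hQ
  | smul c P _ hP => rw [Derivation.map_smul]; exact Submodule.smul_mem _ _ hP
  | mem P hP =>
    obtain ⟨d, ⟨hd, hw⟩, rfl⟩ := hP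
    simp only [gardnerD, mkDerivation_monomial]
    refine Submodule.smul_mem _ _ (Submodule.sum_mem _ fun i hi => ?_)
    have hi1 : Finsupp.single i 1 ≤ d := by
      rw [Finsupp.single_le_iff]
      exact Nat.one_le_iff_ne_zero.2 (Finsupp.mem_support_iff.1 hi)
    have hsplit : d - Finsupp.single i 1 + Finsupp.single i 1 = d := tsub_add_cancel_of_le hi1
    have hdeg : (d - Finsupp.single i 1).degree + 1 = d.degree := by
      conv_rhs => rw [← hsplit]
      simp
    have hwt : Finsupp.weight (fun i : ℕ => i + 2) (d - Finsupp.single i 1) + (i + 2) = N := by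
      rw [← hw]
      conv_rhs => rw [← hsplit]
      simp [Finsupp.weight_single]
    have h1 : monomial (d - Finsupp.single i 1) ((d i : ℕ) : ℝ) ∈
        graded (j - 1) (N - (i + 2)) := by
      refine (monomial_mem_restrictSupport (R := ℝ)).2 (Or.inl ?_)
      simp only [Set.mem_ofPred_eq]
      omega
    have h2 : -X (i + 1) + gardnerQuad (X : ℕ → MvPolynomial ℕ ℝ) i ∈ graded 1 (i + 3) :=
      Submodule.add_mem _ (Submodule.neg_mem _ (X_mem_graded (i + 1)))
        (graded_mono (by norm_num) (gardnerQuad_X_mem_graded i))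
    have h3 := graded_mono (j' := j) (by omega) (mul_mem_graded h1 h2)
    have : N - (i + 2) + (i + 3) = N + 1 := by omega
    rw [this] at h3
    exact h3

lemma graded_le_gradedBelow {j N k : ℕ} (h : N + 1 ≤ k + 2 * j) :
    graded j N ≤ gradedBelow k j N := by
  refine restrictSupport_mono ℝ fun d hd => ⟨hd.1, hd.2, fun i hi => ?_⟩
  obtain ⟨hd, hw⟩ := hd
  have hi1 : Finsupp.single i 1 ≤ d := by
    rw [Finsupp.single_le_iff]
    exact Nat.one_le_iff_ne_zero.2 (Finsupp.mem_support_iff.1 hi)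
  have hsplit : d - Finsupp.single i 1 + Finsupp.single i 1 = d := tsub_add_cancel_of_le hi1
  set e := d - Finsupp.single i 1
  have hwe : 2 * e.degree ≤ Finsupp.weight (fun i : ℕ => i + 2) e := by
    rw [Finsupp.weight_apply, Finsupp.degree_apply, Finset.mul_sum]
    refine Finset.sum_le_sum fun l _ => ?_
    simp only [smul_eq_mul]
    nlinarith [Nat.zero_le (e l * l)]
  rw [← hsplit] at hd hw
  simp only [map_add, Finsupp.degree_single, Finsupp.weight_single, smul_eq_mul] at hd hw
  omega

lemma graded_eq_bot {j N : ℕ} (h : N < 2 * j) : graded j N = ⊥ := by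
  rw [graded, restrictSupport_eq_span, Submodule.span_eq_bot]
  rintro _ ⟨d, ⟨hd, hw⟩, rfl⟩
  have hwe : 2 * d.degree ≤ Finsupp.weight (fun i : ℕ => i + 2) d := by
    rw [Finsupp.weight_apply, Finsupp.degree_apply, Finset.mul_sum]
    refine Finset.sum_le_sum fun l _ => ?_
    simp only [smul_eq_mul]
    nlinarith [Nat.zero_le (d l * l)]
  omega

/-- Every polynomial of weight `2k+4` and degree at least three is, modulo exact terms, a
polynomial in `X₀, …, X_{k-1}`. -/
lemma graded_le_sup_range (k : ℕ) (hk : 1 ≤ k) {j : ℕ} (hj : 3 ≤ j) :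
    graded j (2 * k + 4) ≤ gradedBelow k 3 (2 * k + 4) ⊔ gardnerD.toLinearMap.range := by
  by_cases hbig : 2 * k + 4 < 2 * j
  · rw [graded_eq_bot hbig]; exact bot_le
  have ih := graded_le_sup_range k hk (j := j + 1) (by omega)
  have key : ∀ b : ℕ, ∀ P ∈ graded (j - 1) (k + 3 - b),
      b + 2 ≤ k + 3 → X (k - 1 + b) * P ∈
        gradedBelow k 3 (2 * k + 4) ⊔ gardnerD.toLinearMap.range := by
    intro b
    induction b with
    | zero =>
      intro P hP _
      refine Submodule.mem_sup_left ?_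
      have hX : (X (k - 1) : MvPolynomial ℕ ℝ) ∈ gradedBelow k 1 (k + 1) := by
        refine (monomial_mem_restrictSupport (R := ℝ)).2 (Or.inl ⟨by simp, ?_, fun i hi => ?_⟩)
        · simp [Finsupp.weight_single]; omega
        · have := Finsupp.support_single_subset hi
          simp at this; omega
      have hP' := graded_le_gradedBelow (k := k) (by omega) hP
      refine restrictSupport_mono ℝ ?_
        (restrictSupport_add (R := ℝ) _ _ ▸ Submodule.mul_mem_mul hX hP')
      rintro _ ⟨d, hd, e, he, rfl⟩
      simp only [Set.mem_ofPred_eq] at hd he ⊢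
      refine ⟨by simp only [map_add]; omega, by simp only [map_add]; omega, fun i hi => ?_⟩
      rcases Finset.mem_union.1 (Finsupp.support_add hi) with h | h
      · exact hd.2.2 i h
      · exact he.2.2 i h
    | succ b ihb =>
      intro P hP hb
      have hleib : gardnerD (X (k - 1 + b) * P) =
          X (k - 1 + b) * gardnerD P + P * (-X (k - 1 + (b + 1)) + gardnerQuad X (k - 1 + b)) := by
        rw [Derivation.leibniz, gardnerD_X, smul_eq_mul, smul_eq_mul, add_assoc]
      have heq : X (k - 1 + (b + 1)) * P = X (k - 1 + b) * gardnerD P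
          + gardnerQuad X (k - 1 + b) * P - gardnerD (X (k - 1 + b) * P) := by
        rw [hleib]; ring
      rw [heq]
      refine Submodule.sub_mem _ (Submodule.add_mem _ ?_ ?_)
        (Submodule.mem_sup_right ⟨_, rfl⟩)
      · refine ihb _ ?_ (by omega)
        have := gardnerD_mem_graded hP
        rwa [show k + 3 - (b + 1) + 1 = k + 3 - b by omega] at this
      · apply ih
        have := mul_mem_graded (gardnerQuad_X_mem_graded (k - 1 + b)) hP
        rwa [show 2 + (j - 1) = j + 1 by omega,
          show k - 1 + b + 3 + (k + 3 - (b + 1)) = 2 * k + 4 by omega] at this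
  rw [graded, restrictSupport_eq_span, Submodule.span_le]
  rintro _ ⟨d, ⟨hd, hw⟩, rfl⟩
  by_cases hlow : ∀ i ∈ d.support, i < k
  · refine Submodule.mem_sup_left ?_
    exact (monomial_mem_restrictSupport (R := ℝ)).2 (Or.inl ⟨hj.trans hd, hw, hlow⟩)
  · push Not at hlow
    obtain ⟨i, hi, hki⟩ := hlow
    have hi1 : Finsupp.single i 1 ≤ d := by
      rw [Finsupp.single_le_iff]
      exact Nat.one_le_iff_ne_zero.2 (Finsupp.mem_support_iff.1 hi)
    have hsplit : Finsupp.single i 1 + (d - Finsupp.single i 1) = d :=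
      add_tsub_cancel_of_le hi1
    set e := d - Finsupp.single i 1
    rw [← hsplit] at hd hw
    simp only [map_add, Finsupp.degree_single, Finsupp.weight_single, smul_eq_mul] at hd hw
    have hmon : (monomial d (1 : ℝ)) = X i * monomial e 1 := by
      rw [← hsplit, X, monomial_mul, one_mul]
    have hwe : 2 * e.degree ≤ Finsupp.weight (fun i : ℕ => i + 2) e := by
      rw [Finsupp.weight_apply, Finsupp.degree_apply, Finset.mul_sum]
      refine Finset.sum_le_sum fun l _ => ?_
      simp only [smul_eq_mul]
      nlinarith [Nat.zero_le (e l * l)]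
    have := key (i - (k - 1)) (monomial e 1)
      ((monomial_mem_restrictSupport (R := ℝ)).2 (Or.inl ⟨by omega, by omega⟩)) (by omega)
    rw [show k - 1 + (i - (k - 1)) = i by omega] at this
    change monomial d 1 ∈ _
    rwa [hmon]
termination_by 2 * k + 4 - j

/-- Modulo exact terms, `X_{k+r} X_{k-r}` is `(-1)^r X_k²` up to higher degree terms in the low
variables. -/
lemma X_mul_X_sub_mem (k : ℕ) (hk : 1 ≤ k) (r : ℕ) (hr : r ≤ k) :
    X (k + r) * X (k - r) - (-1) ^ r * X k ^ 2 ∈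
      gradedBelow k 3 (2 * k + 4) ⊔ gardnerD.toLinearMap.range := by
  induction r with
  | zero => simp [sq]
  | succ r ih =>
    have ih := ih (by omega)
    have hcub : ∀ a b : ℕ, a + b + 1 = 2 * k → gardnerQuad X a * X b ∈
        gradedBelow k 3 (2 * k + 4) ⊔ gardnerD.toLinearMap.range := by
      intro a b hab
      apply graded_le_sup_range k hk le_rfl
      have := mul_mem_graded (gardnerQuad_X_mem_graded a) (X_mem_graded b)
      rwa [show a + 3 + (b + 2) = 2 * k + 4 by omega] at this
    have h1 := hcub (k + r) (k - (r + 1)) (by omega)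
    have h2 := hcub (k - (r + 1)) (k + r) (by omega)
    have hleib : gardnerD (X (k + r) * X (k - (r + 1))) =
        X (k + r) * (-X (k - r) + gardnerQuad X (k - (r + 1)))
        + X (k - (r + 1)) * (-X (k + (r + 1)) + gardnerQuad X (k + r)) := by
      rw [Derivation.leibniz, gardnerD_X, gardnerD_X, smul_eq_mul, smul_eq_mul, ← add_assoc k r 1,
        show k - (r + 1) + 1 = k - r by omega]
    have heq : X (k + (r + 1)) * X (k - (r + 1)) - (-1) ^ (r + 1) * X k ^ 2 =
        -(X (k + r) * X (k - r) - (-1) ^ r * X k ^ 2)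
        + gardnerQuad X (k + r) * X (k - (r + 1)) + gardnerQuad X (k - (r + 1)) * X (k + r)
        - gardnerD (X (k + r) * X (k - (r + 1))) := by
      rw [hleib, pow_succ]; ring
    rw [heq]
    exact Submodule.sub_mem _ (Submodule.add_mem _ (Submodule.add_mem _ (Submodule.neg_mem _ ih)
      h1) h2) (Submodule.mem_sup_right ⟨_, rfl⟩)

lemma sum_range_neg_one_pow_add (k : ℕ) :
    ∑ i ∈ Finset.range (2 * k + 1), (-1 : MvPolynomial ℕ ℝ) ^ (i + k) = (-1) ^ k := by
  simp_rw [pow_add]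
  rw [← Finset.sum_mul, neg_one_geom_sum]
  simp

/-- The normal form of the even Gardner densities modulo exact terms. -/
lemma exists_gardner_normal_form (k : ℕ) (hk : 1 ≤ k) :
    ∃ P ∈ gradedBelow k 3 (2 * k + 4), ∃ Q : MvPolynomial ℕ ℝ,
      (6 * (-1) ^ k : ℝ) • X (2 * k + 2) = X k ^ 2 + P + gardnerD Q := by
  have hterm : ∀ i ∈ Finset.range (2 * k + 1),
      X i * X (2 * k - i) - (-1) ^ (i + k) * X k ^ 2 ∈
      gradedBelow k 3 (2 * k + 4) ⊔ gardnerD.toLinearMap.range := by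
    intro i hi
    have hi := Finset.mem_range.1 hi
    rcases le_total k i with h | h
    · obtain ⟨r, rfl⟩ := Nat.exists_eq_add_of_le h
      have := X_mul_X_sub_mem k hk r (by omega)
      rwa [show k - r = 2 * k - (k + r) by omega, show (-1 : MvPolynomial ℕ ℝ) ^ r =
        (-1) ^ (k + r + k) by rw [show k + r + k = r + 2 * k by ring, pow_add]; simp] at this
    · obtain ⟨r, rfl⟩ := Nat.exists_eq_add_of_le h
      have := X_mul_X_sub_mem (i + r) hk r (by omega)
      rwa [show i + r - r = i by omega, mul_comm (X _),
        show i + r + r = 2 * (i + r) - i by omega, show (-1 : MvPolynomial ℕ ℝ) ^ r =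
        (-1) ^ (i + (i + r)) by rw [show i + (i + r) = r + 2 * i by ring, pow_add]; simp] at this
  have hsum := Submodule.sum_mem _ hterm
  rw [Finset.sum_sub_distrib, ← Finset.sum_mul, sum_range_neg_one_pow_add] at hsum
  have hquad : (6 : ℝ) • gardnerQuad (X : ℕ → MvPolynomial ℕ ℝ) (2 * k + 1) =
      ∑ i ∈ Finset.range (2 * k + 1), X i * X (2 * k - i) := by
    simp [gardnerQuad, smul_smul]
  rw [← hquad] at hsum
  obtain ⟨P, hP, _, ⟨Q, rfl⟩, hPQ⟩ := Submodule.mem_sup.1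
    (Submodule.smul_mem _ ((-1 : ℝ) ^ k) hsum)
  refine ⟨P, hP, Q - (6 * (-1) ^ k : ℝ) • X (2 * k + 1), ?_⟩
  rw [map_sub, Derivation.map_smul, gardnerD_X]
  change P + gardnerD Q = _ at hPQ
  have h1 : ((-1 : ℝ) ^ k) • ((-1 : MvPolynomial ℕ ℝ) ^ k * X k ^ 2) = X k ^ 2 := by
    rw [show (-1 : MvPolynomial ℕ ℝ) ^ k = C ((-1 : ℝ) ^ k) by simp, ← smul_eq_C_mul, smul_smul,
      ← mul_pow]
    simp
  rw [smul_sub, h1] at hPQ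
  have h2 : (X k ^ 2 + P + (gardnerD Q) : MvPolynomial ℕ ℝ) =
      (-1 : ℝ) ^ k • (6 : ℝ) • gardnerQuad X (2 * k + 1) := by
    rw [add_assoc, hPQ]; ring
  rw [show (X k ^ 2 + P + (gardnerD Q - (6 * (-1 : ℝ) ^ k) • (-X (2 * k + 1 + 1) +
    gardnerQuad X (2 * k + 1))) : MvPolynomial ℕ ℝ) = (X k ^ 2 + P + gardnerD Q)
    - (6 * (-1 : ℝ) ^ k) • (-X (2 * k + 1 + 1) +
    gardnerQuad X (2 * k + 1)) by ring, h2, smul_smul, smul_add, mul_comm (6 : ℝ), smul_neg]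
  abel

/-- Iterating the derivation on `X₀` gives `±X_n` up to a polynomial of degree at least two. -/
lemma gardnerD_iterate_sub_mem (n : ℕ) :
    gardnerD^[n] (X 0) - (-1) ^ n * X n ∈ graded 2 (n + 2) := by
  induction n with
  | zero => simp
  | succ n ih =>
    rw [Function.iterate_succ_apply']
    have h1 := gardnerD_mem_graded ih
    have hpow : gardnerD ((-1) ^ n * X n) = (-1) ^ n * (-X (n + 1) + gardnerQuad X n) := by
      rw [show (-1 : MvPolynomial ℕ ℝ) ^ n = C ((-1 : ℝ) ^ n) by simp, ← smul_eq_C_mul,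
        Derivation.map_smul, gardnerD_X, smul_eq_C_mul]
    rw [map_sub, hpow] at h1
    have h2 : (-1) ^ n * gardnerQuad (X : ℕ → MvPolynomial ℕ ℝ) n ∈ graded 2 (n + 3) := by
      rw [show (-1 : MvPolynomial ℕ ℝ) ^ n = C ((-1 : ℝ) ^ n) by simp, ← smul_eq_C_mul]
      exact Submodule.smul_mem _ _ (gardnerQuad_X_mem_graded n)
    convert Submodule.add_mem _ h1 h2 using 1
    rw [pow_succ]; ring

end Formal

section Bounds

open MvPolynomial

lemma exists_norm_aeval_le {k j N : ℕ} {P : MvPolynomial ℕ ℝ} (hP : P ∈ gradedBelow k j N)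
    {B : ℝ} (hB : 0 ≤ B) :
    ∃ C : ℝ, 0 ≤ C ∧ ∀ (w : ℕ → DualNumber ℝ) (δ r : ℝ), 0 ≤ δ → δ ≤ 1 → 0 ≤ r →
      (∀ i < k, ‖w i‖ ≤ B * δ * r ^ (i + 2)) → ‖aeval w P‖ ≤ C * δ ^ j * r ^ N := by
  refine ⟨∑ d ∈ P.support, |coeff d P| * B ^ d.degree, by positivity,
    fun w δ r hδ hδ1 hr hw => ?_⟩
  rw [aeval_def, eval₂_eq, Finset.sum_mul, Finset.sum_mul]
  refine (norm_sum_le _ _).trans (Finset.sum_le_sum fun d hd => ?_)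
  obtain ⟨hdeg, hwt, hlow⟩ := hP hd
  have hprod : ‖∏ i ∈ d.support, w i ^ d i‖ ≤ B ^ d.degree * δ ^ d.degree * r ^ N := by
    calc ‖∏ i ∈ d.support, w i ^ d i‖ ≤ ∏ i ∈ d.support, ‖w i ^ d i‖ := Finset.norm_prod_le _ _
      _ ≤ ∏ i ∈ d.support, (B * δ * r ^ (i + 2)) ^ d i := by
        refine Finset.prod_le_prod (fun _ _ => norm_nonneg _) fun i hi => ?_
        exact (norm_pow_le _ _).trans (pow_le_pow_left₀ (norm_nonneg _) (hw i (hlow i hi)) _)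
      _ = B ^ d.degree * δ ^ d.degree * r ^ N := by
        simp_rw [mul_pow, Finset.prod_mul_distrib, ← pow_mul, Finset.prod_pow_eq_pow_sum]
        rw [← hwt, Finsupp.degree_apply, Finsupp.weight_apply, Finsupp.sum]
        simp only [smul_eq_mul, mul_comm]
  calc ‖algebraMap ℝ (DualNumber ℝ) (coeff d P) * ∏ i ∈ d.support, w i ^ d i‖
      ≤ |coeff d P| * (B ^ d.degree * δ ^ d.degree * r ^ N) := by
        rw [← Algebra.smul_def, norm_smul, Real.norm_eq_abs]
        gcongr
    _ ≤ |coeff d P| * (B ^ d.degree * δ ^ j * r ^ N) := by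
        gcongr ?_ * (_ * ?_ * _)
        exact pow_le_pow_of_le_one hδ hδ1 hdeg
    _ = _ := by ring

lemma exists_norm_sub_le (n : ℕ) {B : ℝ} (hB : 0 ≤ B) :
    ∃ C : ℝ, 0 ≤ C ∧ ∀ (w : ℕ → DualNumber ℝ) (δ r : ℝ), 0 ≤ δ → δ ≤ 1 → 0 ≤ r →
      (∀ i < n, ‖w i‖ ≤ B * δ * r ^ (i + 2)) →
      ‖aeval w (gardnerD^[n] (X 0)) - (-1) ^ n * w n‖ ≤ C * δ ^ 2 * r ^ (n + 2) := by
  obtain ⟨C, hC, h⟩ := exists_norm_aeval_le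
    (graded_le_gradedBelow (k := n) (by omega) (gardnerD_iterate_sub_mem n)) hB
  refine ⟨C, hC, fun w δ r hδ hδ1 hr hw => ?_⟩
  simpa using h w δ r hδ hδ1 hr hw

/-- Bounds on the iterated derivatives of `w₀` give bounds on the Gardner densities. -/
lemma exists_norm_density_le (n : ℕ) (B : ℝ) :
    ∃ C : ℝ, 0 ≤ C ∧ ∀ (w : ℕ → DualNumber ℝ) (δ r : ℝ), 0 ≤ δ → δ ≤ 1 → 0 ≤ r →
      (∀ i < n, ‖aeval w (gardnerD^[i] (X 0))‖ ≤ B * δ * r ^ (i + 2)) →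
      ∀ i < n, ‖w i‖ ≤ C * δ * r ^ (i + 2) := by
  induction n with
  | zero => exact ⟨0, le_rfl, fun _ _ _ _ _ _ _ i hi => absurd hi (Nat.not_lt_zero i)⟩
  | succ n ih =>
    obtain ⟨C, hC, h⟩ := ih
    obtain ⟨C', hC', h'⟩ := exists_norm_sub_le n hC
    refine ⟨max C (B + C'), le_max_of_le_left hC, fun w δ r hδ hδ1 hr hw i hi => ?_⟩
    have hlow := h w δ r hδ hδ1 hr fun i hi => hw i (by omega)
    rcases Nat.lt_succ_iff_lt_or_eq.1 hi with hi | rfl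
    · refine (hlow i hi).trans ?_
      gcongr
      exact le_max_left _ _
    · have h1 := h' w δ r hδ hδ1 hr hlow
      have h2 := hw i hi
      have h3 : ‖w i‖ = ‖(-1) ^ i * w i‖ := by
        rcases neg_one_pow_eq_or (DualNumber ℝ) i with h | h <;> simp [h]
      have h4 : δ ^ 2 ≤ δ := by nlinarith
      calc ‖w i‖ ≤ ‖aeval w (gardnerD^[i] (X 0))‖
            + ‖aeval w (gardnerD^[i] (X 0)) - (-1) ^ i * w i‖ := by
            rw [h3]
            exact norm_le_insert _ _
        _ ≤ B * δ * r ^ (i + 2) + C' * δ ^ 2 * r ^ (i + 2) := add_le_add h2 h1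
        _ ≤ B * δ * r ^ (i + 2) + C' * δ * r ^ (i + 2) := by gcongr
        _ = (B + C') * δ * r ^ (i + 2) := by ring
        _ ≤ _ := by gcongr; exact le_max_right _ _

end Bounds

section Algebra

open PowerSeries in
lemma coeff_succ_X_sq_mul {R : Type*} [CommRing R] (F G : R⟦X⟧) (n : ℕ) :
    coeff (n + 1) (X ^ 2 * (F * G)) =
      ∑ i ∈ Finset.range n, coeff i F * coeff (n - 1 - i) G := by
  rw [coeff_X_pow_mul']
  rcases n with _ | n
  · simp
  · rw [if_pos (by omega), coeff_mul, Finset.Nat.sum_antidiagonal_eq_sum_range_succ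
      (fun i j => coeff i F * coeff j G)]
    simp

variable {R : Type*} [CommRing R] [Algebra ℝ R]

/-- A sequence satisfying the Gardner recursion has derivatives computed by `gardnerD`. -/
lemma aeval_gardnerD (D : Derivation ℝ R R) {w : ℕ → R}
    (hw : ∀ n, D (w n) = -w (n + 1) + gardnerQuad w n) (P : MvPolynomial ℕ ℝ) :
    MvPolynomial.aeval w (gardnerD P) = D (MvPolynomial.aeval w P) := by
  induction P using MvPolynomial.induction_on with
  | C a => simp [MvPolynomial.algHom_C, Derivation.map_algebraMap]
  | add P Q hP hQ => simp only [map_add, hP, hQ]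
  | mul_X P i hP =>
    simp only [Derivation.leibniz, map_add, map_mul, smul_eq_mul, hP, gardnerD_X,
      MvPolynomial.aeval_X, hw, map_neg, gardnerQuad, map_smul, map_sum]

lemma aeval_gardnerD_iterate (D : Derivation ℝ R R) {w : ℕ → R}
    (hw : ∀ n, D (w n) = -w (n + 1) + gardnerQuad w n) (n : ℕ) :
    MvPolynomial.aeval w (gardnerD^[n] (MvPolynomial.X 0)) = D^[n] (w 0) := by
  induction n with
  | zero => simp
  | succ n ih => rw [Function.iterate_succ_apply', Function.iterate_succ_apply',
      aeval_gardnerD D hw, ih]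

/-- The Gardner densities of `u`. -/
def gardnerSeq (D : Derivation ℝ R R) (u : R) : ℕ → R
  | 0 => u
  | n + 1 => -D (gardnerSeq D u n) +
      (1 / 6 : ℝ) • ∑ i : Fin n, gardnerSeq D u i * gardnerSeq D u (n - 1 - i)
decreasing_by all_goals omega

lemma gardnerSeq_zero (D : Derivation ℝ R R) (u : R) : gardnerSeq D u 0 = u := by
  rw [gardnerSeq]

lemma D_gardnerSeq (D : Derivation ℝ R R) (u : R) (n : ℕ) :
    D (gardnerSeq D u n) = -gardnerSeq D u (n + 1) + gardnerQuad (gardnerSeq D u) n := by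
  rw [gardnerSeq, gardnerQuad, ← Fin.sum_univ_eq_sum_range
    (fun i => gardnerSeq D u i * gardnerSeq D u (n - 1 - i))]
  ring

open PowerSeries in
/-- The coefficientwise extension of a derivation to power series. -/
def seriesDerivation (D : Derivation ℝ R R) : Derivation ℝ R⟦X⟧ R⟦X⟧ :=
  Derivation.mk'
    { toFun := fun F => PowerSeries.mk fun n => D (coeff n F)
      map_add' := fun F G => by ext; simp
      map_smul' := fun c F => by ext; simp }
    fun F G => by
      ext n
      simp only [LinearMap.coe_mk, AddHom.coe_mk, coeff_mk, coeff_mul, map_sum, map_add,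
        smul_eq_mul, Derivation.leibniz, Finset.sum_add_distrib]
      congr 1
      rw [← Finset.Nat.sum_antidiagonal_swap]
      rfl

open PowerSeries in
lemma coeff_seriesDerivation (D : Derivation ℝ R R) (F : R⟦X⟧) (n : ℕ) :
    coeff n (seriesDerivation D F) = D (coeff n F) := by
  change coeff n (PowerSeries.mk fun n => D (coeff n F)) = _
  simp

open PowerSeries in
lemma seriesDerivation_X (D : Derivation ℝ R R) : seriesDerivation D (X : R⟦X⟧) = 0 := by
  ext n
  rw [coeff_seriesDerivation, coeff_X]
  split_ifs <;> simp

open PowerSeries in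
lemma seriesDerivation_C (D : Derivation ℝ R R) (a : R) :
    seriesDerivation D (C a) = C (D a) := by
  ext n
  rw [coeff_seriesDerivation, coeff_C, coeff_C]
  split_ifs <;> simp

open PowerSeries in
/-- Gardner's transformation: the residual of the KdV equation for `u` generates the residuals
`h n` of the conservation laws for the Gardner densities. -/
lemma exists_gardner_residual (D T : Derivation ℝ R R) (hDT : ∀ a, T (D a) = D (T a)) (u : R) :
    ∃ h flux : ℕ → R, h 0 = T u + u * D u + D (D (D u)) ∧
      (∀ n, D (h n) = -h (n + 1) +
        (1 / 6 : ℝ) • ∑ i ∈ Finset.range n, (gardnerSeq D u i * h (n - 1 - i)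
          + h i * gardnerSeq D u (n - 1 - i))) ∧
      ∀ n, T (gardnerSeq D u n) = h n + D (flux n) := by
  set 𝒟 := seriesDerivation D with h𝒟
  set 𝒯 := seriesDerivation T with h𝒯
  set W : R⟦X⟧ := PowerSeries.mk (gardnerSeq D u) with hW
  set c : R⟦X⟧ := algebraMap ℝ R⟦X⟧ (1 / 6) with hc
  have h6 : 6 * c = 1 := by
    have : (6 : R⟦X⟧) = algebraMap ℝ R⟦X⟧ 6 := (map_ofNat _ 6).symm
    rw [this, hc, ← map_mul]; norm_num
  have h2 : 2 * (3 * c) = 1 := by rw [← h6]; ring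
  have hDc : 𝒟 c = 0 := Derivation.map_algebraMap _ _
  have hTc : 𝒯 c = 0 := Derivation.map_algebraMap _ _
  have hDX : 𝒟 X = 0 := seriesDerivation_X D
  have hTX : 𝒯 X = 0 := seriesDerivation_X T
  have hcomm : ∀ F, 𝒯 (𝒟 F) = 𝒟 (𝒯 F) := fun F => by
    ext n
    simp only [h𝒟, h𝒯, coeff_seriesDerivation, hDT]
  have hu : C u = W + X * 𝒟 W - c * (X ^ 2 * (W * W)) := by
    ext n
    rcases n with _ | n
    · simp [hW, gardnerSeq_zero]
    · rw [hc, ← Algebra.smul_def]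
      simp only [map_add, map_sub, coeff_succ_X_mul, LinearMap.map_smul_of_tower,
        coeff_succ_X_sq_mul, coeff_C, h𝒟, coeff_seriesDerivation, hW, coeff_mk, D_gardnerSeq,
        gardnerQuad]
      simp
  set G : R⟦X⟧ := 𝒯 W + W * 𝒟 W - c * X ^ 2 * W ^ 2 * 𝒟 W + 𝒟 (𝒟 (𝒟 W)) with hG
  have hg : C (T u + u * D u + D (D (D u))) = G + X * 𝒟 G - 2 * (c * (X ^ 2 * (W * G))) := by
    simp only [map_add, map_mul, ← seriesDerivation_C]
    rw [← h𝒟, ← h𝒯, hu, hG]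
    simp only [map_add, map_sub, Derivation.leibniz, Derivation.leibniz_pow, smul_eq_mul, hDc, hTc,
      hDX, hTX, hcomm, mul_zero, add_zero, smul_zero,
      nsmul_eq_mul]
    norm_num
    linear_combination (-(X : R⟦X⟧) ^ 2 * 𝒟 W * 𝒟 (𝒟 W)) * h6
  refine ⟨fun n => coeff n G, fun n => coeff n (-(3 * c * W ^ 2) + 2 * c ^ 2 * X ^ 2 * W ^ 3
    - 𝒟 (𝒟 W)), ?_, fun n => ?_, fun n => ?_⟩
  · have := congrArg (coeff 0) hg
    simpa using this.symm
  · have := congrArg (coeff (n + 1)) hg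
    rw [hc, ← Algebra.smul_def] at this
    have h2s : (2 : R⟦X⟧) * ((1 / 6 : ℝ) • (X ^ 2 * (W * G))) =
      (1 / 6 : ℝ) • (X ^ 2 * (W * G) + X ^ 2 * (G * W)) := by
      rw [mul_smul_comm]; congr 1; ring
    rw [h2s] at this
    simp only [map_add, map_sub, coeff_succ_X_mul, LinearMap.map_smul_of_tower, coeff_succ_X_sq_mul,
      coeff_C, h𝒟, coeff_seriesDerivation] at this
    rw [← Finset.sum_add_distrib] at this
    simp only [hW, coeff_mk, Nat.add_eq_zero_iff, one_ne_zero, and_false, if_false] at this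
    linear_combination -this
  · have : 𝒯 W = G + 𝒟 (-(3 * c * W ^ 2) + 2 * c ^ 2 * X ^ 2 * W ^ 3 - 𝒟 (𝒟 W)) := by
      rw [hG]
      simp only [map_add, map_sub, map_neg, Derivation.leibniz, Derivation.leibniz_pow,
        smul_eq_mul, hDc,
        hDX, mul_zero, add_zero, smul_zero, nsmul_eq_mul,
        show 𝒟 2 = 0 from Derivation.map_natCast _ 2, show 𝒟 3 = 0 from Derivation.map_natCast _ 3]
      norm_num
      linear_combination (-(W * 𝒟 W) * 1 + c * X ^ 2 * W ^ 2 * 𝒟 W) * (-h6)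
    have := congrArg (coeff n) this
    rw [map_add, h𝒯, h𝒟, coeff_seriesDerivation, coeff_seriesDerivation] at this
    simpa [hW] using this

/-- The extension of a derivation to dual numbers. -/
def dualDerivation (D : Derivation ℝ R R) : Derivation ℝ (DualNumber R) (DualNumber R) :=
  Derivation.mk'
    { toFun := fun a => TrivSqZeroExt.inl (D a.fst) + TrivSqZeroExt.inr (D a.snd)
      map_add' := fun a b => by ext <;> simp
      map_smul' := fun c a => by ext <;> simp }
    fun a b => by
      ext
      · simp
      · simp only [LinearMap.coe_mk, AddHom.coe_mk, TrivSqZeroExt.snd_add, TrivSqZeroExt.snd_inl,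
          TrivSqZeroExt.snd_inr, TrivSqZeroExt.snd_mul, TrivSqZeroExt.fst_add,
          TrivSqZeroExt.fst_inl, TrivSqZeroExt.fst_inr, smul_eq_mul, MulOpposite.smul_eq_mul_unop,
          MulOpposite.unop_op, map_add, Derivation.leibniz]
        ring

lemma fst_dualDerivation (D : Derivation ℝ R R) (a : DualNumber R) :
    (dualDerivation D a).fst = D a.fst := by
  change (TrivSqZeroExt.inl (D a.fst) + TrivSqZeroExt.inr (D a.snd) : DualNumber R).fst = _
  simp

lemma snd_dualDerivation (D : Derivation ℝ R R) (a : DualNumber R) :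
    (dualDerivation D a).snd = D a.snd := by
  change (TrivSqZeroExt.inl (D a.fst) + TrivSqZeroExt.inr (D a.snd) : DualNumber R).snd = _
  simp

end Algebra

section Energy

variable {R : Type*} [CommRing R] [Algebra ℝ R]

/-- The Gardner densities together with their residuals, as dual numbers. -/
lemma exists_dual_densities (D T : Derivation ℝ R R) (hDT : ∀ a, T (D a) = D (T a)) (u : R) :
    ∃ W : ℕ → DualNumber R,
      W 0 = TrivSqZeroExt.inl u + TrivSqZeroExt.inr (T u + u * D u + D (D (D u))) ∧
      (∀ n, dualDerivation D (W n) = -W (n + 1) + gardnerQuad W n) ∧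
      ∀ n, ∃ q, T (W n).fst = (W n).snd + D q := by
  obtain ⟨h, flux, h0, hh, hT⟩ := exists_gardner_residual D T hDT u
  refine ⟨fun n => TrivSqZeroExt.inl (gardnerSeq D u n) + TrivSqZeroExt.inr (h n), ?_, fun n => ?_,
    fun n => ⟨flux n, ?_⟩⟩
  · simp [h0, gardnerSeq_zero]
  · ext
    · rw [fst_dualDerivation]
      simp [D_gardnerSeq, gardnerQuad, TrivSqZeroExt.fst_sum]
    · rw [snd_dualDerivation]
      simp [hh, gardnerQuad, TrivSqZeroExt.snd_sum, mul_comm]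
  · simp [hT]

/-- The conservation law with residual for the energy in normal form. -/
lemma exists_energy_balance {D T : Derivation ℝ R R} (hDT : ∀ a, T (D a) = D (T a))
    {W : ℕ → DualNumber R} (hW : ∀ n, dualDerivation D (W n) = -W (n + 1) + gardnerQuad W n)
    (hT : ∀ n, ∃ q, T (W n).fst = (W n).snd + D q) {k : ℕ} {P Q : MvPolynomial ℕ ℝ}
    (hPQ : (6 * (-1) ^ k : ℝ) • MvPolynomial.X (2 * k + 2) =
      MvPolynomial.X k ^ 2 + P + gardnerD Q) :
    ∃ q, T (W k ^ 2 + MvPolynomial.aeval W P).fst =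
      (W k ^ 2 + MvPolynomial.aeval W P).snd + D q := by
  obtain ⟨q, hq⟩ := hT (2 * k + 2)
  have h := congrArg (MvPolynomial.aeval W) hPQ
  simp only [map_add, map_pow, map_smul, MvPolynomial.aeval_X,
    aeval_gardnerD _ hW] at h
  have hE : W k ^ 2 + MvPolynomial.aeval W P = (6 * (-1) ^ k : ℝ) • W (2 * k + 2)
      - dualDerivation D (MvPolynomial.aeval W Q) := by rw [h]; ring
  refine ⟨(6 * (-1) ^ k : ℝ) • q - T (MvPolynomial.aeval W Q).fst
    + (MvPolynomial.aeval W Q).snd, ?_⟩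
  rw [hE]
  simp only [TrivSqZeroExt.fst_sub, TrivSqZeroExt.snd_sub, TrivSqZeroExt.fst_smul,
    TrivSqZeroExt.snd_smul, fst_dualDerivation, snd_dualDerivation, map_sub, map_add,
    Derivation.map_smul, hDT, hq, smul_add]
  ring

/-- Evaluation of a dual number along an algebra homomorphism. -/
def dualEval (φ : R →ₐ[ℝ] ℝ) (a : DualNumber R) : DualNumber ℝ :=
  TrivSqZeroExt.inl (φ a.fst) + TrivSqZeroExt.inr (φ a.snd)

lemma aeval_dualEval (φ : R →ₐ[ℝ] ℝ) (W : ℕ → DualNumber R) (P : MvPolynomial ℕ ℝ) :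
    MvPolynomial.aeval (fun n => dualEval φ (W n)) P =
      dualEval φ (MvPolynomial.aeval W P) := by
  induction P using MvPolynomial.induction_on with
  | C a =>
    ext <;> simp [dualEval, MvPolynomial.algHom_C, TrivSqZeroExt.algebraMap_eq_inl']
  | add P Q hP hQ =>
    rw [map_add, hP, hQ, map_add]
    ext <;> simp [dualEval]
  | mul_X P i hP =>
    rw [map_mul, hP, map_mul]
    ext <;> simp [dualEval]

lemma iterate_dualDerivation (D : Derivation ℝ R R) (a b : R) (n : ℕ) :
    (dualDerivation D)^[n] (TrivSqZeroExt.inl a + TrivSqZeroExt.inr b) =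
      TrivSqZeroExt.inl (D^[n] a) + TrivSqZeroExt.inr (D^[n] b) := by
  induction n with
  | zero => simp
  | succ n ih =>
    rw [Function.iterate_succ_apply', ih, Function.iterate_succ_apply',
      Function.iterate_succ_apply']
    ext
    · rw [fst_dualDerivation]; simp
    · rw [snd_dualDerivation]; simp

end Energy

section SmoothFunctions

/-- Smooth functions on space-time that are `2π`-periodic in space at positive times. -/
def periodicFunctions : Subalgebra ℝ (ℝ × ℝ → ℝ) where
  carrier := {F | ContDiff ℝ (⊤ : ℕ∞) F ∧
    ∀ t x : ℝ, 0 < t → F (t, x + 2 * Real.pi) = F (t, x)}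
  mul_mem' := fun ha hb => ⟨ha.1.mul hb.1, fun t x ht => by simp [ha.2 t x ht, hb.2 t x ht]⟩
  add_mem' := fun ha hb => ⟨ha.1.add hb.1, fun t x ht => by simp [ha.2 t x ht, hb.2 t x ht]⟩
  algebraMap_mem' := fun _ => ⟨contDiff_const, fun _ _ _ => rfl⟩

lemma differentiable_coe (F : periodicFunctions) :
    Differentiable ℝ (F : ℝ × ℝ → ℝ) :=
  F.2.1.differentiable (by simp)

lemma continuous_coe (F : periodicFunctions) :
    Continuous (F : ℝ × ℝ → ℝ) :=
  F.2.1.continuous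

lemma continuous_slice (F : periodicFunctions) (t : ℝ) :
    Continuous fun x => (F : ℝ × ℝ → ℝ) (t, x) :=
  (continuous_coe F).comp (by fun_prop)

/-- Differentiation in a fixed direction. -/
def directional (v : ℝ × ℝ) : Derivation ℝ periodicFunctions periodicFunctions :=
  Derivation.mk'
    { toFun := fun F => ⟨fun p => fderiv ℝ (F : ℝ × ℝ → ℝ) p v,
        (F.2.1.fderiv_right (m := (⊤ : ℕ∞)) (by simp)).clm_apply contDiff_const, by
          intro t x ht
          have h : (fun p : ℝ × ℝ => (F : ℝ × ℝ → ℝ) (p + (0, 2 * Real.pi)))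
              =ᶠ[nhds (t, x)] (F : ℝ × ℝ → ℝ) := by
            have : ∀ᶠ p : ℝ × ℝ in nhds (t, x), 0 < p.1 :=
              (isOpen_lt continuous_const continuous_fst).mem_nhds ht
            filter_upwards [this] with p hp
            have := F.2.2 p.1 p.2 hp
            simpa [Prod.add_def] using this
          change fderiv ℝ (F : ℝ × ℝ → ℝ) (t, x + 2 * Real.pi) v = fderiv ℝ _ (t, x) v
          have h2 := h.fderiv_eq (𝕜 := ℝ)
          rw [fderiv_comp_add_right] at h2
          simp only [Prod.mk_add_mk, add_zero] at h2
          rw [h2]⟩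
      map_add' := fun F G => by
        ext p
        change fderiv ℝ ((F : ℝ × ℝ → ℝ) + (G : ℝ × ℝ → ℝ)) p v = _
        rw [fderiv_add (differentiable_coe F p) (differentiable_coe G p)]
        rfl
      map_smul' := fun c F => by
        ext p
        change fderiv ℝ (c • (F : ℝ × ℝ → ℝ)) p v = _
        rw [fderiv_const_smul (differentiable_coe F p)]
        rfl }
    fun F G => by
      ext p
      change fderiv ℝ ((F : ℝ × ℝ → ℝ) * (G : ℝ × ℝ → ℝ)) p v = _
      rw [fderiv_mul (differentiable_coe F p) (differentiable_coe G p)]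
      rfl

lemma directional_apply (v : ℝ × ℝ) (F : periodicFunctions) (p : ℝ × ℝ) :
    (directional v F : ℝ × ℝ → ℝ) p = fderiv ℝ (F : ℝ × ℝ → ℝ) p v := rfl

lemma directional_comm (v w : ℝ × ℝ) (F : periodicFunctions) :
    directional v (directional w F) = directional w (directional v F) := by
  ext p
  have hd : DifferentiableAt ℝ (fderiv ℝ (F : ℝ × ℝ → ℝ)) p :=
    (F.2.1.fderiv_right (m := (⊤ : ℕ∞)) (by simp)).differentiable (by simp) p
  have key : ∀ a b : ℝ × ℝ, (directional a (directional b F) : ℝ × ℝ → ℝ) p =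
      fderiv ℝ (fderiv ℝ (F : ℝ × ℝ → ℝ)) p a b := fun a b => by
    rw [directional_apply]
    change fderiv ℝ (fun p => fderiv ℝ (F : ℝ × ℝ → ℝ) p b) p a = _
    rw [fderiv_clm_apply hd (differentiableAt_const _)]
    simp
  rw [key, key]
  exact (F.2.1.contDiffAt.isSymmSndFDerivAt (by
    rw [minSmoothness_of_isRCLikeNormedField]
    exact WithTop.coe_le_coe.2 le_top)).eq v w

/-- The space derivative. -/
abbrev dX : Derivation ℝ periodicFunctions periodicFunctions := directional (0, 1)

/-- The time derivative. -/
abbrev dT : Derivation ℝ periodicFunctions periodicFunctions := directional (1, 0)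

lemma hasDerivAt_dX (F : periodicFunctions) (t x : ℝ) :
    HasDerivAt (fun y => (F : ℝ × ℝ → ℝ) (t, y)) ((dX F : ℝ × ℝ → ℝ) (t, x)) x :=
  (differentiable_coe F (t, x)).hasFDerivAt.comp_hasDerivAt x
    ((hasDerivAt_const x t).prodMk (hasDerivAt_id x))

lemma hasDerivAt_dT (F : periodicFunctions) (t x : ℝ) :
    HasDerivAt (fun s => (F : ℝ × ℝ → ℝ) (s, x)) ((dT F : ℝ × ℝ → ℝ) (t, x)) t :=
  (differentiable_coe F (t, x)).hasFDerivAt.comp_hasDerivAt t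
    ((hasDerivAt_id t).prodMk (hasDerivAt_const t x))

lemma iterate_dX (F : periodicFunctions) (n : ℕ) (t x : ℝ) :
    (dX^[n] F : ℝ × ℝ → ℝ) (t, x) = iteratedDeriv n (fun y => (F : ℝ × ℝ → ℝ) (t, y)) x := by
  induction n generalizing x with
  | zero => simp
  | succ n ih =>
    rw [Function.iterate_succ_apply', iteratedDeriv_succ, ← funext ih]
    exact (hasDerivAt_dX _ t x).deriv.symm

lemma integral_dX (F : periodicFunctions) {t : ℝ} (ht : 0 < t) :
    ∫ x in (0:ℝ)..(2 * Real.pi), (dX F : ℝ × ℝ → ℝ) (t, x) = 0 := by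
  rw [intervalIntegral.integral_eq_sub_of_hasDerivAt (fun x _ => hasDerivAt_dX F t x)
    ((continuous_slice (dX F) t).intervalIntegrable _ _)]
  have := F.2.2 t 0 ht
  rw [zero_add] at this
  rw [this, sub_self]

lemma hasDerivAt_integral (F : periodicFunctions) (t : ℝ) :
    HasDerivAt (fun s => ∫ x in (0:ℝ)..(2 * Real.pi), (F : ℝ × ℝ → ℝ) (s, x))
      (∫ x in (0:ℝ)..(2 * Real.pi), (dT F : ℝ × ℝ → ℝ) (t, x)) t := by
  obtain ⟨C, hC⟩ := ((isCompact_closedBall t 1).prod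
    (isCompact_uIcc (a := (0:ℝ)) (b := 2 * Real.pi))).exists_bound_of_continuousOn
    (continuous_coe (dT F)).continuousOn
  refine (intervalIntegral.hasDerivAt_integral_of_dominated_loc_of_deriv_le
    (F' := fun s x => (dT F : ℝ × ℝ → ℝ) (s, x)) (bound := fun _ => C)
    (Metric.closedBall_mem_nhds t one_pos) ?_ ?_ ?_ ?_ ?_ ?_).2
  · exact Filter.Eventually.of_forall fun s =>
      (continuous_slice F s).aestronglyMeasurable
  · exact (continuous_slice F t).intervalIntegrable _ _
  · exact (continuous_slice (dT F) t).aestronglyMeasurable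
  · exact Filter.Eventually.of_forall fun x hx s hs =>
      hC (s, x) ⟨hs, Set.uIoc_subset_uIcc hx⟩
  · simp
  · exact Filter.Eventually.of_forall fun x _ s _ => hasDerivAt_dT F s x

end SmoothFunctions

section PeriodicNorms

lemma L2norm_nonneg (v : ℝ → ℝ) : 0 ≤ L2norm v := Real.sqrt_nonneg _

lemma sq_L2norm (v : ℝ → ℝ) : L2norm v ^ 2 = ∫ x in (0:ℝ)..(2 * Real.pi), v x ^ 2 :=
  Real.sq_sqrt (intervalIntegral.integral_nonneg (by positivity) fun _ _ => sq_nonneg _)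

lemma L2norm_abs (v : ℝ → ℝ) : L2norm (fun x => |v x|) = L2norm v := by
  simp [L2norm]

lemma abs_integral_mul_le {a b : ℝ → ℝ} (ha : Continuous a) (hb : Continuous b) :
    |∫ x in (0:ℝ)..(2 * Real.pi), a x * b x| ≤ L2norm a * L2norm b := by
  have hI : ∀ c : ℝ → ℝ, Continuous c → IntervalIntegrable c volume 0 (2 * Real.pi) :=
    fun c hc => hc.intervalIntegrable _ _
  have key : ∀ s : ℝ, 0 ≤ L2norm b ^ 2 * (s * s)
      + (2 * ∫ x in (0:ℝ)..(2 * Real.pi), a x * b x) * s + L2norm a ^ 2 := fun s => by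
    have h : ∫ x in (0:ℝ)..(2 * Real.pi), (a x + s * b x) ^ 2 = L2norm b ^ 2 * (s * s)
        + (2 * ∫ x in (0:ℝ)..(2 * Real.pi), a x * b x) * s + L2norm a ^ 2 := by
      have e : ∀ x, (a x + s * b x) ^ 2 = (s * s) * b x ^ 2 + (2 * s) * (a x * b x) + a x ^ 2 :=
        fun x => by ring
      simp only [e]
      rw [intervalIntegral.integral_add (hI _ (by fun_prop)) (hI _ (by fun_prop)),
        intervalIntegral.integral_add (hI _ (by fun_prop)) (hI _ (by fun_prop)),
        intervalIntegral.integral_const_mul, intervalIntegral.integral_const_mul,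
        sq_L2norm, sq_L2norm]
      ring
    rw [← h]
    exact intervalIntegral.integral_nonneg (by positivity) fun _ _ => sq_nonneg _
  have hd := discrim_le_zero key
  rw [discrim] at hd
  apply abs_le_of_sq_le_sq _ (mul_nonneg (L2norm_nonneg a) (L2norm_nonneg b))
  nlinarith

lemma integral_abs_le {a : ℝ → ℝ} (ha : Continuous a) :
    ∫ x in (0:ℝ)..(2 * Real.pi), |a x| ≤ Real.sqrt (2 * Real.pi) * L2norm a := by
  have h := abs_integral_mul_le (a := fun _ => 1) (b := fun x => |a x|) continuous_const ha.abs
  rw [L2norm_abs] at h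
  have h1 : L2norm (fun _ => 1) = Real.sqrt (2 * Real.pi) := by simp [L2norm]
  rw [h1] at h
  simpa using (le_abs_self _).trans h

namespace SmoothMeanZeroPeriodic

variable {v : ℝ → ℝ}

protected lemma continuous (hv : SmoothMeanZeroPeriodic v) : Continuous v := hv.1.continuous

lemma hasDerivAt (hv : SmoothMeanZeroPeriodic v) (x : ℝ) : HasDerivAt v (deriv v x) x :=
  (hv.1.differentiable (by simp) x).hasDerivAt

protected lemma deriv (hv : SmoothMeanZeroPeriodic v) : SmoothMeanZeroPeriodic (deriv v) := by
  have hc : ContDiff ℝ (⊤ : ℕ∞) (deriv v) :=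
    (contDiff_succ_iff_deriv (n := (⊤ : ℕ∞)).1 (by simpa using hv.1)).2.2
  refine ⟨hc, fun x => ?_, ?_⟩
  · rw [← deriv_comp_add_const, funext hv.2.1]
  · rw [intervalIntegral.integral_eq_sub_of_hasDerivAt (fun x _ => hv.hasDerivAt x)
      (hc.continuous.intervalIntegrable _ _)]
    have := hv.2.1 0
    rw [zero_add] at this
    rw [this, sub_self]

protected lemma iteratedDeriv (hv : SmoothMeanZeroPeriodic v) (n : ℕ) :
    SmoothMeanZeroPeriodic (iteratedDeriv n v) := by
  induction n with
  | zero => simpa using hv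
  | succ n ih => rw [iteratedDeriv_succ]; exact ih.deriv

lemma exists_eq_zero (hv : SmoothMeanZeroPeriodic v) :
    ∃ c ∈ Set.Icc 0 (2 * Real.pi), v c = 0 := by
  obtain ⟨c, hc, h⟩ := exists_hasDerivAt_eq_zero (a := 0) (b := 2 * Real.pi)
    (f := fun x => ∫ y in (0:ℝ)..x, v y) (f' := v) (by positivity)
    (continuous_iff_continuousAt.2 fun x =>
      (hv.continuous.integral_hasStrictDerivAt 0 x).hasDerivAt.continuousAt).continuousOn
    (by simp [hv.2.2])
    fun x _ => (hv.continuous.integral_hasStrictDerivAt 0 x).hasDerivAt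
  exact ⟨c, Set.Ioo_subset_Icc_self hc, h⟩

/-- Agmon's inequality. -/
lemma sq_le (hv : SmoothMeanZeroPeriodic v) {x : ℝ} (hx : x ∈ Set.Icc 0 (2 * Real.pi)) :
    v x ^ 2 ≤ 2 * (L2norm v * L2norm (deriv v)) := by
  obtain ⟨c, hc, h0⟩ := hv.exists_eq_zero
  have hcont : Continuous fun y => 2 * (v y * deriv v y) :=
    continuous_const.mul (hv.continuous.mul hv.deriv.continuous)
  have h1 : ∫ y in c..x, 2 * (v y * deriv v y) = v x ^ 2 := by
    rw [intervalIntegral.integral_eq_sub_of_hasDerivAt (f := fun y => v y ^ 2)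
      (fun y _ => ((hv.hasDerivAt y).fun_pow 2).congr_deriv (by
        norm_num [mul_assoc])) (hcont.intervalIntegrable _ _), h0]
    simp
  have h2 : |∫ y in c..x, 2 * (v y * deriv v y)| ≤
      ∫ y in (0:ℝ)..(2 * Real.pi), |2 * (v y * deriv v y)| := by
    rw [intervalIntegral.integral_of_le (by positivity : (0:ℝ) ≤ 2 * Real.pi), ← Real.norm_eq_abs]
    refine intervalIntegral.norm_integral_le_integral_norm_uIoc.trans ?_
    apply setIntegral_mono_set (hcont.abs.integrableOn_Ioc)
      (Filter.Eventually.of_forall fun _ => abs_nonneg _)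
    exact (Set.Ioc_subset_Ioc (le_min hc.1 hx.1) (max_le hc.2 hx.2)).eventuallyLE
  have h3 := abs_integral_mul_le hv.continuous.abs hv.deriv.continuous.abs
  rw [L2norm_abs, L2norm_abs] at h3
  rw [h1] at h2
  simp only [abs_mul, abs_two, intervalIntegral.integral_const_mul] at h2
  linarith [le_abs_self (v x ^ 2), le_abs_self (∫ x in (0:ℝ)..(2 * Real.pi), |v x| * |deriv v x|)]

/-- Poincaré's inequality. -/
lemma L2norm_le (hv : SmoothMeanZeroPeriodic v) :
    L2norm v ≤ 4 * Real.pi * L2norm (deriv v) := by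
  have h : L2norm v ^ 2 ≤ ∫ _ in (0:ℝ)..(2 * Real.pi), 2 * (L2norm v * L2norm (deriv v)) := by
    rw [sq_L2norm]
    exact intervalIntegral.integral_mono_on (by positivity)
      ((hv.continuous.pow 2).intervalIntegrable _ _) (by simp) fun x hx => hv.sq_le hx
  rw [intervalIntegral.integral_const, smul_eq_mul, sub_zero] at h
  rcases (L2norm_nonneg v).eq_or_lt with h0 | h0
  · rw [← h0]
    exact mul_nonneg (by positivity) (L2norm_nonneg _)
  · refine le_of_mul_le_mul_left ?_ h0
    nlinarith

lemma sq_L2norm_deriv_le (hv : SmoothMeanZeroPeriodic v) :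
    L2norm (deriv v) ^ 2 ≤ L2norm v * L2norm (deriv (deriv v)) := by
  have hc1 := hv.deriv.continuous
  have hc2 := hv.deriv.deriv.continuous
  have hc0 := hv.continuous
  have h : ∫ x in (0:ℝ)..(2 * Real.pi), (deriv v x ^ 2 + v x * deriv (deriv v) x) = 0 := by
    rw [intervalIntegral.integral_eq_sub_of_hasDerivAt (f := fun x => v x * deriv v x)
      (fun x _ => ((hv.hasDerivAt x).fun_mul (hv.deriv.hasDerivAt x)).congr_deriv (by ring))
      (Continuous.intervalIntegrable (by fun_prop) _ _)]
    have h1 := hv.2.1 0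
    have h2 := hv.deriv.2.1 0
    rw [zero_add] at h1 h2
    rw [h1, h2, sub_self]
  rw [intervalIntegral.integral_add (Continuous.intervalIntegrable (by fun_prop) _ _)
    (Continuous.intervalIntegrable (by fun_prop) _ _), ← sq_L2norm] at h
  have := abs_integral_mul_le hv.continuous hc2
  linarith [neg_abs_le (∫ x in (0:ℝ)..(2 * Real.pi), v x * deriv (deriv v) x)]

end SmoothMeanZeroPeriodic

end PeriodicNorms

section Interpolation

lemma le_one_of_sq_le_mul {m : ℕ → ℝ} (h0 : ∀ a, 0 ≤ m a)
    (h : ∀ a, m (a + 1) ^ 2 ≤ m a * m (a + 2)) {k : ℕ} (hm : m 0 ≤ 1) (hk : m k ≤ 1) {a : ℕ}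
    (ha : a ≤ k) : m a ≤ 1 := by
  induction a with
  | zero => exact hm
  | succ a ih =>
    specialize ih (by omega)
    by_contra! hlt
    have key : ∀ j, m (a + j) ≤ m (a + j + 1) ∧ 1 < m (a + j + 1) := fun j => by
      induction j with
      | zero => exact ⟨ih.trans hlt.le, hlt⟩
      | succ j ihj =>
        have h1 := h (a + j)
        have h2 : m (a + j + 1) ≤ m (a + j + 2) := by
          by_contra! h3
          nlinarith [h0 (a + j + 2), h0 (a + j)]
        exact ⟨h2, ihj.2.trans_le h2⟩
    have := (key (k - (a + 1))).2
    rw [show a + (k - (a + 1)) + 1 = k by omega] at this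
    linarith

lemma le_mul_pow_of_sq_le_mul {n : ℕ → ℝ} (h0 : ∀ a, 0 ≤ n a)
    (h : ∀ a, n (a + 1) ^ 2 ≤ n a * n (a + 2)) {k : ℕ} {l R : ℝ} (hl : 0 < l) (hR : 0 < R)
    (hn : n 0 ≤ l) (hk : n k ≤ l * R ^ k) {a : ℕ} (ha : a ≤ k) : n a ≤ l * R ^ a := by
  have hpos : ∀ a, 0 < l * R ^ a := fun a => by positivity
  have := le_one_of_sq_le_mul (m := fun a => n a / (l * R ^ a))
    (fun a => div_nonneg (h0 a) (hpos a).le) (fun a => ?_) (k := k)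
    (by simpa using (div_le_one hl).2 hn) ((div_le_one (hpos k)).2 hk) ha
  · exact (div_le_one (hpos a)).1 this
  · rw [div_pow, div_mul_div_comm,
      show l * R ^ a * (l * R ^ (a + 2)) = (l * R ^ (a + 1)) ^ 2 by ring]
    exact div_le_div_of_nonneg_right (h a) (sq_nonneg _)

namespace SmoothMeanZeroPeriodic

variable {v : ℝ → ℝ}

lemma Hnorm_le_mul_pow (hv : SmoothMeanZeroPeriodic v) {k : ℕ} {l R : ℝ} (hl : 0 < l)
    (hR : 0 < R) (h0 : L2norm v ≤ l) (hk : Hnorm k v ≤ l * R ^ k) {a : ℕ} (ha : a ≤ k) :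
    Hnorm a v ≤ l * R ^ a :=
  le_mul_pow_of_sq_le_mul (n := fun a => Hnorm a v) (fun _ => L2norm_nonneg _)
    (fun a => by
      simpa only [Hnorm, iteratedDeriv_succ] using (hv.iteratedDeriv a).sq_L2norm_deriv_le)
    hl hR (by simpa [Hnorm] using h0) hk ha

lemma abs_iteratedDeriv_le (hv : SmoothMeanZeroPeriodic v) {k : ℕ} {l r : ℝ} (hl : 0 < l)
    (hr : 0 < r) (h0 : L2norm v ≤ l) (hk : Hnorm k v ≤ l * r ^ (2 * k)) {a : ℕ} (ha : a < k)
    {x : ℝ} (hx : x ∈ Set.Icc 0 (2 * Real.pi)) :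
    |iteratedDeriv a v x| ≤ 2 * (l * r ^ (2 * a + 1)) := by
  rw [pow_mul] at hk
  have h1 := hv.Hnorm_le_mul_pow hl (pow_pos hr 2) h0 hk ha.le
  have h2 := hv.Hnorm_le_mul_pow hl (pow_pos hr 2) h0 hk (Nat.succ_le_of_lt ha)
  have h3 := (hv.iteratedDeriv a).sq_le hx
  rw [← iteratedDeriv_succ] at h3
  change _ ≤ 2 * (Hnorm a v * Hnorm (a + 1) v) at h3
  have h4 : Hnorm a v * Hnorm (a + 1) v ≤ (l * (r ^ 2) ^ a) * (l * (r ^ 2) ^ (a + 1)) :=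
    mul_le_mul h1 h2 (L2norm_nonneg _) (by positivity)
  apply abs_le_of_sq_le_sq _ (by positivity)
  have h5 : (l * (r ^ 2) ^ a) * (l * (r ^ 2) ^ (a + 1)) = (l * r ^ (2 * a + 1)) ^ 2 := by ring
  nlinarith [sq_nonneg (l * r ^ (2 * a + 1))]

lemma Hnorm_le (hv : SmoothMeanZeroPeriodic v) {a k : ℕ} (ha : a ≤ k) :
    Hnorm a v ≤ (4 * Real.pi) ^ k * Hnorm k v := by
  have hpi : 1 ≤ 4 * Real.pi := by linarith [Real.pi_gt_three]
  have key : ∀ j, Hnorm a v ≤ (4 * Real.pi) ^ j * Hnorm (a + j) v := fun j => by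
    induction j with
    | zero => simp
    | succ j ih =>
      have := (hv.iteratedDeriv (a + j)).L2norm_le
      rw [← iteratedDeriv_succ] at this
      refine ih.trans ?_
      rw [pow_succ, mul_assoc]
      exact mul_le_mul_of_nonneg_left this (by positivity)
  obtain ⟨j, rfl⟩ := Nat.exists_eq_add_of_le ha
  exact (key j).trans (mul_le_mul_of_nonneg_right
    (pow_le_pow_right₀ hpi (by omega)) (L2norm_nonneg _))

lemma abs_iteratedDeriv_le_of_Hnorm_le (hv : SmoothMeanZeroPeriodic v) {k : ℕ} {M : ℝ}
    (hM : Hnorm k v ≤ M) {a : ℕ} (ha : a < k) {x : ℝ} (hx : x ∈ Set.Icc 0 (2 * Real.pi)) :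
    |iteratedDeriv a v x| ≤ 2 * ((4 * Real.pi) ^ k * M) := by
  have hM0 : 0 ≤ M := (L2norm_nonneg _).trans hM
  have hle : (4 * Real.pi) ^ k * Hnorm k v ≤ (4 * Real.pi) ^ k * M :=
    mul_le_mul_of_nonneg_left hM (by positivity)
  have h1 := (hv.Hnorm_le ha.le).trans hle
  have h2 := (hv.Hnorm_le (Nat.succ_le_of_lt ha)).trans hle
  have h3 := (hv.iteratedDeriv a).sq_le hx
  rw [← iteratedDeriv_succ] at h3
  change _ ≤ 2 * (Hnorm a v * Hnorm (a + 1) v) at h3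
  have h4 := mul_le_mul h1 h2 (L2norm_nonneg _) (by positivity)
  apply abs_le_of_sq_le_sq _ (by positivity)
  nlinarith [sq_nonneg ((4 * Real.pi) ^ k * M)]

end SmoothMeanZeroPeriodic

end Interpolation

section PointwiseEnergy

/-- The energy density agrees with the square of the top derivative up to lower order terms. -/
lemma exists_abs_energy_sub_le {k : ℕ} {P : MvPolynomial ℕ ℝ}
    (hP : P ∈ gradedBelow k 3 (2 * k + 4)) (B : ℝ) :
    ∃ C, 0 ≤ C ∧ ∀ (w : ℕ → DualNumber ℝ) (δ r a b : ℝ), 0 ≤ δ → δ ≤ 1 → 0 ≤ r →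
      (∀ i < k, ‖MvPolynomial.aeval w (gardnerD^[i] (MvPolynomial.X 0))‖ ≤ B * δ * r ^ (i + 2)) →
      MvPolynomial.aeval w (gardnerD^[k] (MvPolynomial.X 0)) =
        TrivSqZeroExt.inl a + TrivSqZeroExt.inr b →
      |(w k ^ 2 + MvPolynomial.aeval w P).fst - a ^ 2| ≤
        C * (|a| * (δ ^ 2 * r ^ (k + 2)) + δ ^ 3 * r ^ (2 * k + 4)) ∧
      |(w k ^ 2 + MvPolynomial.aeval w P).snd - 2 * (a * b)| ≤
        C * ((|a| + |b|) * (δ ^ 2 * r ^ (k + 2)) + δ ^ 3 * r ^ (2 * k + 4)) := by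
  obtain ⟨C₁, hC₁, h₁⟩ := exists_norm_density_le k B
  obtain ⟨C₂, hC₂, h₂⟩ := exists_norm_sub_le k hC₁
  obtain ⟨C₃, hC₃, h₃⟩ := exists_norm_aeval_le hP hC₁
  refine ⟨2 * C₂ + 2 * C₂ ^ 2 + C₃, by positivity, fun w δ r a b hδ hδ1 hr h hab => ?_⟩
  have hw := h₁ w δ r hδ hδ1 hr h
  have hd := h₂ w δ r hδ hδ1 hr hw
  have hp := h₃ w δ r hδ hδ1 hr hw
  rw [hab] at hd
  set d := TrivSqZeroExt.inl a + TrivSqZeroExt.inr b - (-1) ^ k * w k with hd_def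
  have hwk : w k ^ 2 = (TrivSqZeroExt.inl a + TrivSqZeroExt.inr b - d) ^ 2 := by
    rw [hd_def, sub_sub_cancel, mul_pow, ← pow_mul, mul_comm k 2, pow_mul]
    simp
  have hfst : (w k ^ 2).fst = a ^ 2 - 2 * (a * d.fst) + d.fst ^ 2 := by
    rw [hwk, sq]
    simp
    ring
  have hsnd : (w k ^ 2).snd = 2 * (a * b) - 2 * (a * d.snd + b * d.fst)
      + 2 * (d.fst * d.snd) := by
    rw [hwk, sq]
    simp
    ring
  rw [TrivSqZeroExt.norm_def, Real.norm_eq_abs, Real.norm_eq_abs] at hd hp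
  set e := δ ^ 2 * r ^ (k + 2) with he
  set z := δ ^ 3 * r ^ (2 * k + 4) with hz
  have he0 : 0 ≤ e := by positivity
  have hz0 : 0 ≤ z := by positivity
  have hez : e ^ 2 ≤ z := by
    have : e ^ 2 = δ * z := by rw [he, hz]; ring
    rw [this]
    exact mul_le_of_le_one_left hz0 hδ1
  have hd1 : |d.fst| ≤ C₂ * e := by
    rw [he, ← mul_assoc]; linarith [abs_nonneg d.snd]
  have hd2 : |d.snd| ≤ C₂ * e := by
    rw [he, ← mul_assoc]; linarith [abs_nonneg d.fst]
  have hp1 : |(MvPolynomial.aeval w P).fst| ≤ C₃ * z := by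
    rw [hz, ← mul_assoc]; linarith [abs_nonneg (MvPolynomial.aeval w P).snd]
  have hp2 : |(MvPolynomial.aeval w P).snd| ≤ C₃ * z := by
    rw [hz, ← mul_assoc]; linarith [abs_nonneg (MvPolynomial.aeval w P).fst]
  have hprod : ∀ p q : ℝ, |p| ≤ C₂ * e → |q| ≤ C₂ * e → |p * q| ≤ C₂ ^ 2 * z := fun p q h1 h2 => by
    rw [abs_mul]
    calc |p| * |q| ≤ (C₂ * e) * (C₂ * e) := mul_le_mul h1 h2 (abs_nonneg _) (by positivity)
      _ = C₂ ^ 2 * e ^ 2 := by ring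
      _ ≤ C₂ ^ 2 * z := by gcongr
  have hlin : ∀ p q : ℝ, |q| ≤ C₂ * e → |p * q| ≤ C₂ * (|p| * e) := fun p q h1 => by
    rw [abs_mul]
    calc |p| * |q| ≤ |p| * (C₂ * e) := mul_le_mul_of_nonneg_left h1 (abs_nonneg _)
      _ = C₂ * (|p| * e) := by ring
  have hae : 0 ≤ |a| * e := by positivity
  have hbe : 0 ≤ |b| * e := by positivity
  have hcoef1 : 0 ≤ C₂ ^ 2 * (|a| * e) := by positivity
  have hcoef2 : 0 ≤ C₃ * (|a| * e) := by positivity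
  have hcoef3 : 0 ≤ C₂ * z := by positivity
  have hcoef4 : 0 ≤ C₂ ^ 2 * z := by positivity
  have hcoef5 : 0 ≤ C₂ ^ 2 * (|b| * e) := by positivity
  have hcoef6 : 0 ≤ C₃ * (|b| * e) := by positivity
  constructor
  · rw [TrivSqZeroExt.fst_add, hfst]
    have h1 := abs_le.1 (hlin a _ hd1)
    have h2 := abs_le.1 (hprod _ _ hd1 hd1)
    have h3 := abs_le.1 hp1
    have h4 : (2 * C₂ + 2 * C₂ ^ 2 + C₃) * (|a| * e + z) = 2 * (C₂ * (|a| * e))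
        + 2 * (C₂ ^ 2 * (|a| * e)) + C₃ * (|a| * e) + 2 * (C₂ * z) + 2 * (C₂ ^ 2 * z)
        + C₃ * z := by ring
    rw [abs_le, h4]
    constructor <;> linarith
  · rw [TrivSqZeroExt.snd_add, hsnd]
    have h1 := abs_le.1 (hlin a _ hd2)
    have h1' := abs_le.1 (hlin b _ hd1)
    have h2 := abs_le.1 (hprod _ _ hd1 hd2)
    have h3 := abs_le.1 hp2
    have h4 : (2 * C₂ + 2 * C₂ ^ 2 + C₃) * ((|a| + |b|) * e + z) = 2 * (C₂ * (|a| * e))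
        + 2 * (C₂ ^ 2 * (|a| * e)) + C₃ * (|a| * e) + 2 * (C₂ * (|b| * e))
        + 2 * (C₂ ^ 2 * (|b| * e)) + C₃ * (|b| * e) + 2 * (C₂ * z) + 2 * (C₂ ^ 2 * z)
        + C₃ * z := by ring
    rw [abs_le, h4]
    constructor <;> linarith

end PointwiseEnergy

section Solution

lemma hasDerivAt_integral_of_balance {E S q : periodicFunctions} (h : dT E = S + dX q) {t : ℝ}
    (ht : 0 < t) :
    HasDerivAt (fun s => ∫ x in (0:ℝ)..(2 * Real.pi), (E : ℝ × ℝ → ℝ) (s, x))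
      (∫ x in (0:ℝ)..(2 * Real.pi), (S : ℝ × ℝ → ℝ) (t, x)) t := by
  refine (hasDerivAt_integral E t).congr_deriv ?_
  rw [h]
  change ∫ x in (0:ℝ)..(2 * Real.pi), ((S : ℝ × ℝ → ℝ) (t, x) + (dX q : ℝ × ℝ → ℝ) (t, x)) = _
  rw [intervalIntegral.integral_add
    ((continuous_slice S t).intervalIntegrable _ _)
    ((continuous_slice (dX q) t).intervalIntegrable _ _),
    integral_dX q ht, add_zero]

/-- The defect of the undamped, unforced equation. -/
def kdvDefect (U : periodicFunctions) : periodicFunctions := dT U + U * dX U + dX (dX (dX U))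

/-- Evaluation at a space-time point. -/
def pointEval (p : ℝ × ℝ) : periodicFunctions →ₐ[ℝ] ℝ :=
  (Pi.evalAlgHom ℝ (fun _ : ℝ × ℝ => ℝ) p).comp periodicFunctions.val

lemma pointEval_apply (p : ℝ × ℝ) (F : periodicFunctions) :
    pointEval p F = (F : ℝ × ℝ → ℝ) p := rfl

namespace IsDampedKdVSol

variable {γ : ℝ} {f : ℝ → ℝ} {u : ℝ → ℝ → ℝ}

/-- A solution as a space-time function. -/
def toPeriodic (hu : IsDampedKdVSol γ f u) : periodicFunctions :=
  ⟨fun p => u p.1 p.2, hu.1, fun t x ht => (hu.2.1 t ht.le).2.1 x⟩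

lemma toPeriodic_apply (hu : IsDampedKdVSol γ f u) (t x : ℝ) :
    (hu.toPeriodic : ℝ × ℝ → ℝ) (t, x) = u t x := rfl

lemma iterate_dX_toPeriodic (hu : IsDampedKdVSol γ f u) (n : ℕ) (t x : ℝ) :
    (dX^[n] hu.toPeriodic : ℝ × ℝ → ℝ) (t, x) = iteratedDeriv n (u t) x :=
  iterate_dX _ n t x

lemma kdvDefect_apply (hu : IsDampedKdVSol γ f u) {t : ℝ} (ht : 0 ≤ t) (x : ℝ) :
    (kdvDefect hu.toPeriodic : ℝ × ℝ → ℝ) (t, x) = f x - γ * u t x := by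
  have h1 := (hasDerivAt_dT hu.toPeriodic t x).deriv
  have h2 := (hasDerivAt_dX hu.toPeriodic t x).deriv
  have h3 := hu.iterate_dX_toPeriodic 3 t x
  have h := hu.2.2 t x ht
  simp only [toPeriodic_apply] at h1 h2
  change (dT hu.toPeriodic : ℝ × ℝ → ℝ) (t, x) + u t x * (dX hu.toPeriodic : ℝ × ℝ → ℝ) (t, x)
    + (dX^[3] hu.toPeriodic : ℝ × ℝ → ℝ) (t, x) = _
  rw [h3, ← h1, ← h2]
  change _ + u t x * deriv (u t) x + _ = _
  linarith

lemma iterate_dX_kdvDefect (hu : IsDampedKdVSol γ f u) (hf : SmoothMeanZeroPeriodic f) {t : ℝ}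
    (ht : 0 ≤ t) (n : ℕ) (x : ℝ) :
    (dX^[n] (kdvDefect hu.toPeriodic) : ℝ × ℝ → ℝ) (t, x) =
      iteratedDeriv n f x - γ * iteratedDeriv n (u t) x := by
  rw [iterate_dX, funext (hu.kdvDefect_apply ht)]
  have h1 : ContDiffAt ℝ n f x := (hf.1.of_le (by exact_mod_cast le_top)).contDiffAt
  have h2 : ContDiffAt ℝ n (u t) x :=
    ((hu.2.1 t ht).1.of_le (by exact_mod_cast le_top)).contDiffAt
  rw [iteratedDeriv_fun_sub h1 (contDiffAt_const.mul h2), iteratedDeriv_const_mul_field]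

lemma hasDerivAt_sq_L2norm (hu : IsDampedKdVSol γ f u) (hf : SmoothMeanZeroPeriodic f) {t : ℝ}
    (ht : 0 < t) :
    HasDerivAt (fun s => L2norm (u s) ^ 2)
      (-2 * γ * L2norm (u t) ^ 2 + 2 * ∫ x in (0:ℝ)..(2 * Real.pi), u t x * f x) t := by
  have hbal : dT (hu.toPeriodic ^ 2) = 2 * (hu.toPeriodic * kdvDefect hu.toPeriodic)
      + dX (-((2 / 3 : ℝ) • hu.toPeriodic ^ 3) - 2 * (hu.toPeriodic * dX (dX hu.toPeriodic))
        + dX hu.toPeriodic ^ 2) := by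
    have h2 : dX (2 : periodicFunctions) = 0 := by
      simpa using dX.map_natCast 2
    simp only [kdvDefect, map_add, map_sub, map_neg, Derivation.leibniz, Derivation.leibniz_pow,
      Derivation.map_smul, smul_eq_mul, h2]
    have h3 : ∀ a : periodicFunctions, (2 / 3 : ℝ) • (3 • a) = 2 • a := fun a => by
      rw [← Nat.cast_smul_eq_nsmul ℝ, smul_smul, ← Nat.cast_smul_eq_nsmul ℝ]
      norm_num
    rw [h3]
    simp only [nsmul_eq_mul]
    push_cast
    ring
  have h := hasDerivAt_integral_of_balance hbal ht
  simp only [sq_L2norm]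
  refine h.congr_deriv ?_
  change ∫ x in (0:ℝ)..(2 * Real.pi), 2 * (u t x * (kdvDefect hu.toPeriodic : ℝ × ℝ → ℝ) (t, x))
    = _
  have hc := (hu.2.1 t ht.le).continuous
  have hfc := hf.continuous
  have e : ∀ x, 2 * (u t x * (f x - γ * u t x)) = (-2 * γ) * u t x ^ 2 + 2 * (u t x * f x) :=
    fun x => by ring
  simp only [hu.kdvDefect_apply ht.le, e]
  rw [intervalIntegral.integral_add (Continuous.intervalIntegrable (by fun_prop) _ _)
    (Continuous.intervalIntegrable (by fun_prop) _ _), intervalIntegral.integral_const_mul,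
    intervalIntegral.integral_const_mul]

end IsDampedKdVSol

end Solution

section Gronwall

/-- A differential form of Grönwall's inequality. -/
lemma exp_mul_le_of_deriv_le {J J' Θ Θ' : ℝ → ℝ} {c t : ℝ} (ht : 0 ≤ t) (hJ : Continuous J)
    (hJ' : ∀ s, 0 < s → HasDerivAt J (J' s) s) (hΘ : ∀ s, HasDerivAt Θ (Θ' s) s)
    (h : ∀ s, 0 < s → s < t → Real.exp (c * s) * (J' s + c * J s) ≤ Θ' s) :
    Real.exp (c * t) * J t ≤ J 0 + Θ t - Θ 0 := by
  have hexp : ∀ s, HasDerivAt (fun s => Real.exp (c * s)) (Real.exp (c * s) * c) s := fun s =>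
    (((hasDerivAt_id s).const_mul c).exp).congr_deriv (by simp)
  have hder : ∀ s, 0 < s → HasDerivAt (fun s => Real.exp (c * s) * J s - Θ s)
      (Real.exp (c * s) * (J' s + c * J s) - Θ' s) s := fun s hs =>
    (((hexp s).fun_mul (hJ' s hs)).fun_sub (hΘ s)).congr_deriv (by ring)
  have hΘc : Continuous Θ := continuous_iff_continuousAt.2 fun s => (hΘ s).continuousAt
  have hanti : AntitoneOn (fun s => Real.exp (c * s) * J s - Θ s) (Set.Icc 0 t) := by
    refine antitoneOn_of_deriv_nonpos (convex_Icc 0 t)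
      (Continuous.continuousOn (by fun_prop)) (fun s hs => ?_) fun s hs => ?_
    · rw [interior_Icc] at hs
      exact (hder s hs.1).differentiableAt.differentiableWithinAt
    · rw [interior_Icc] at hs
      rw [(hder s hs.1).deriv]
      linarith [h s hs.1 hs.2]
  have := hanti ⟨le_rfl, ht⟩ ⟨ht, le_rfl⟩ ht
  simp only [mul_zero, Real.exp_zero, one_mul] at this
  linarith

lemma exists_max_exp_mul {y : ℝ → ℝ} (hy : Continuous y) (γ : ℝ) {t : ℝ} (ht : 0 ≤ t) :
    ∃ s₀ ∈ Set.Icc 0 t, ∀ s ∈ Set.Icc 0 t,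
      Real.exp (γ * s) * y s ≤ Real.exp (γ * s₀) * y s₀ :=
  isCompact_Icc.exists_isMaxOn (Set.nonempty_Icc.2 ht)
    (f := fun s => Real.exp (γ * s) * y s) (Continuous.continuousOn (by fun_prop))

/-- The `L²` decay estimate, abstractly. -/
lemma le_of_deriv_sq_le {y Y' : ℝ → ℝ} {γ m t : ℝ} (hγ : 0 < γ) (hm : 0 ≤ m)
    (hy : Continuous y) (hy0 : ∀ s, 0 ≤ y s)
    (hd : ∀ s, 0 < s → HasDerivAt (fun s => y s ^ 2) (Y' s) s)
    (h : ∀ s, 0 < s → Y' s ≤ -2 * γ * y s ^ 2 + 2 * (y s * m)) (ht : 0 ≤ t) :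
    y t ≤ Real.exp (-γ * t) * y 0 + 2 * m / γ := by
  obtain ⟨s₀, hs₀, hmax⟩ := exists_max_exp_mul hy γ ht
  set S := Real.exp (γ * s₀) * y s₀ with hS
  have hS0 : 0 ≤ S := mul_nonneg (Real.exp_nonneg _) (hy0 _)
  have hyS : y 0 ≤ S := by simpa using hmax 0 ⟨le_rfl, ht⟩
  have hsq : ∀ s, Real.exp (2 * γ * s) = Real.exp (γ * s) ^ 2 := fun s => by
    rw [← Real.exp_nat_mul]; ring_nf
  have key := exp_mul_le_of_deriv_le (c := 2 * γ) (Θ := fun s => 2 * m * S / γ * Real.exp (γ * s))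
    (Θ' := fun s => 2 * m * S * Real.exp (γ * s)) hs₀.1 (hy.pow 2) hd
    (fun s => ((((hasDerivAt_id s).const_mul γ).exp).const_mul _).congr_deriv (by
      simp; field_simp))
    (fun s hs hst => by
      have h1 := hmax s ⟨hs.le, hst.le.trans hs₀.2⟩
      have h2 : Y' s + 2 * γ * y s ^ 2 ≤ 2 * (y s * m) := by linarith [h s hs]
      calc Real.exp (2 * γ * s) * (Y' s + 2 * γ * y s ^ 2)
          ≤ Real.exp (2 * γ * s) * (2 * (y s * m)) :=
            mul_le_mul_of_nonneg_left h2 (Real.exp_nonneg _)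
        _ = 2 * m * (Real.exp (γ * s) * y s) * Real.exp (γ * s) := by rw [hsq]; ring
        _ ≤ 2 * m * S * Real.exp (γ * s) := by gcongr)
  simp only [mul_zero, Real.exp_zero, mul_one, Pi.pow_apply] at key
  have hle : Real.exp (γ * s₀) ≤ Real.exp (γ * t) := by
    gcongr
    exact hs₀.2
  have hb : S ≤ y 0 + 2 * m / γ * Real.exp (γ * t) := by
    rcases hS0.eq_or_lt with h0 | h0
    · rw [← h0]
      have := hy0 0
      positivity
    · refine le_of_mul_le_mul_right ?_ h0
      have h1 : S * S = Real.exp (2 * γ * s₀) * y s₀ ^ 2 := by rw [hsq, hS]; ring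
      have h2 : 2 * m * S / γ * Real.exp (γ * s₀) ≤ 2 * m * S / γ * Real.exp (γ * t) := by
        gcongr
      have h3 : 0 ≤ 2 * m * S / γ := by positivity
      have h4 : y 0 ^ 2 ≤ y 0 * S := by rw [sq]; exact mul_le_mul_of_nonneg_left hyS (hy0 0)
      calc S * S ≤ y 0 * S + 2 * m * S / γ * Real.exp (γ * t) := by rw [h1]; linarith
        _ = _ := by ring
  have hinv : Real.exp (-γ * t) * Real.exp (γ * t) = 1 := by
    rw [← Real.exp_add]; simp
  calc y t = Real.exp (-γ * t) * (Real.exp (γ * t) * y t) := by rw [← mul_assoc, hinv, one_mul]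
    _ ≤ Real.exp (-γ * t) * (y 0 + 2 * m / γ * Real.exp (γ * t)) := by
      gcongr
      exact (hmax t ⟨ht, le_rfl⟩).trans hb
    _ = Real.exp (-γ * t) * y 0 + 2 * m / γ * (Real.exp (-γ * t) * Real.exp (γ * t)) := by ring
    _ = _ := by rw [hinv, mul_one]

end Gronwall

section Bootstrap

lemma exp_mul_error_le {k : ℕ} (hk : 1 ≤ k) {γ ν A C L n s : ℝ} (hνk : ν * (2 * k) = γ)
    (hνγ : ν ≤ γ) (hγ : 0 ≤ γ) (hA : 0 ≤ A) (hC : 0 ≤ C) (hL : 0 ≤ L) (hn : 0 ≤ n) (hs : 0 ≤ s) :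
    Real.exp (2 * γ * s) *
        (C * ((A + Real.exp (-γ * s) * L) ^ 3 * (n * Real.exp (-ν * s)) ^ (4 * k - 1))) ≤
      4 * C * n ^ (4 * k - 1) * (A ^ 3 * Real.exp (ν * s) + L ^ 3 * Real.exp (-γ * s)) := by
  have h1 : Real.exp (2 * γ * s) * Real.exp (-ν * s) ^ (4 * k - 1) = Real.exp (ν * s) := by
    rw [← Real.exp_nat_mul, ← Real.exp_add, Nat.cast_sub (by omega)]
    congr 1
    push_cast
    rw [← hνk]
    ring
  have h2 : (A + Real.exp (-γ * s) * L) ^ 3 ≤ 4 * (A ^ 3 + L ^ 3 * Real.exp (-γ * s) ^ 3) := by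
    have := add_pow_le hA (by positivity : 0 ≤ Real.exp (-γ * s) * L) 3
    calc _ ≤ _ := this
      _ = _ := by ring
  have h3 : Real.exp (-γ * s) ^ 3 * Real.exp (ν * s) ≤ Real.exp (-γ * s) := by
    rw [← Real.exp_nat_mul, ← Real.exp_add]
    apply Real.exp_le_exp.2
    push_cast
    nlinarith [hs]
  calc _ = C * n ^ (4 * k - 1) * (A + Real.exp (-γ * s) * L) ^ 3 *
        (Real.exp (2 * γ * s) * Real.exp (-ν * s) ^ (4 * k - 1)) := by rw [mul_pow]; ring
    _ ≤ C * n ^ (4 * k - 1) * (4 * (A ^ 3 + L ^ 3 * Real.exp (-γ * s) ^ 3)) *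
        Real.exp (ν * s) := by rw [h1]; gcongr
    _ = 4 * C * n ^ (4 * k - 1) * (A ^ 3 * Real.exp (ν * s)
        + L ^ 3 * (Real.exp (-γ * s) ^ 3 * Real.exp (ν * s))) := by ring
    _ ≤ _ := by gcongr

lemma add_exp_mul_le {γ ν A L K t s : ℝ} (hνγ : ν ≤ γ) (hν0 : 0 ≤ ν) (hA : 1 ≤ A)
    (hK : A + 1 ≤ K) (hL : 0 ≤ L) (hs : s ∈ Set.Icc 0 t) :
    A + Real.exp (-γ * s) * L ≤ K * (Real.exp (ν * t) + L ^ 3) * Real.exp (-ν * s) := by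
  have hK0 : 0 ≤ K := by linarith
  have hgs : Real.exp (-γ * s) ≤ Real.exp (-ν * s) := by
    apply Real.exp_le_exp.2
    nlinarith [hs.1]
  have hν1 : Real.exp (-ν * s) ≤ 1 := by
    apply Real.exp_le_one_iff.2
    nlinarith [hs.1]
  have h1 : 1 ≤ Real.exp (ν * t) * Real.exp (-ν * s) := by
    rw [← Real.exp_add]
    apply Real.one_le_exp
    nlinarith [hs.2]
  have h2 : L ≤ 1 + L ^ 3 := by
    rcases le_total L 1 with h | h
    · linarith [pow_nonneg hL 3]
    · linarith [le_self_pow₀ h (by norm_num : (3:ℕ) ≠ 0)]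
  have h3 : Real.exp (-γ * s) * L ≤ 1 + L ^ 3 * Real.exp (-ν * s) := by
    calc Real.exp (-γ * s) * L ≤ Real.exp (-ν * s) * (1 + L ^ 3) := by gcongr
      _ = Real.exp (-ν * s) + L ^ 3 * Real.exp (-ν * s) := by ring
      _ ≤ _ := by linarith
  have h4 : 0 ≤ L ^ 3 * Real.exp (-ν * s) := by positivity
  calc _ ≤ (A + 1) * (1 + L ^ 3 * Real.exp (-ν * s)) := by nlinarith
    _ ≤ K * (Real.exp (ν * t) * Real.exp (-ν * s) + L ^ 3 * Real.exp (-ν * s)) := by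
      gcongr
    _ = _ := by ring

lemma exp_mul_sq_le_of_energy_estimate {γ ν A L N t : ℝ} {y J J' : ℝ → ℝ} (hγ : 0 < γ)
    (hν0 : 0 < ν) (hA0 : 0 ≤ A) (hL : 0 ≤ L) (hN : 0 ≤ N) (hJ : Continuous J)
    (hJ' : ∀ s, 0 < s → HasDerivAt J (J' s) s)
    (hest : ∀ s ∈ Set.Icc 0 t,
      Real.exp (2 * γ * s) * |J s - y s ^ 2| ≤
          N * (A ^ 3 * Real.exp (ν * s) + L ^ 3 * Real.exp (-γ * s)) ∧
        Real.exp (2 * γ * s) * (J' s + 2 * γ * J s) ≤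
          N * (A ^ 3 * Real.exp (ν * s) + L ^ 3 * Real.exp (-γ * s)))
    {s₀ : ℝ} (hs₀ : s₀ ∈ Set.Icc 0 t) :
    Real.exp (2 * γ * s₀) * y s₀ ^ 2 ≤ y 0 ^ 2 +
      N * ((A ^ 3 / ν + 1 / γ + 2 * A ^ 3 + 2) * (Real.exp (ν * t) + L ^ 3)) := by
  have ht : 0 ≤ t := hs₀.1.trans hs₀.2
  have hderiv : ∀ s, HasDerivAt (fun s => A ^ 3 / ν * Real.exp (ν * s)
      - L ^ 3 / γ * Real.exp (-γ * s)) (A ^ 3 * Real.exp (ν * s) + L ^ 3 * Real.exp (-γ * s)) s :=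
    fun s => (((((hasDerivAt_id s).const_mul ν).exp).const_mul _).fun_sub
        ((((hasDerivAt_id s).const_mul (-γ)).exp).const_mul _)).congr_deriv (by
          simp; field_simp)
  have key := exp_mul_le_of_deriv_le (c := 2 * γ) hs₀.1 hJ hJ' (fun s => (hderiv s).const_mul N)
    (fun s hs hst => (hest s ⟨hs.le, hst.le.trans hs₀.2⟩).2)
  obtain ⟨h1, -⟩ := hest s₀ hs₀
  obtain ⟨h2, -⟩ := hest 0 ⟨le_rfl, ht⟩
  simp only [mul_zero, Real.exp_zero, mul_one, one_mul] at key h2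
  have hexp1 : Real.exp (ν * s₀) ≤ Real.exp (ν * t) := by
    gcongr
    exact hs₀.2
  have hexp2 : Real.exp (-γ * s₀) ≤ 1 := by
    apply Real.exp_le_one_iff.2
    nlinarith [hs₀.1]
  have hexp3 : 1 ≤ Real.exp (ν * t) := Real.one_le_exp (by positivity)
  have h3 : Real.exp (2 * γ * s₀) * y s₀ ^ 2 ≤ Real.exp (2 * γ * s₀) * J s₀
      + Real.exp (2 * γ * s₀) * |J s₀ - y s₀ ^ 2| := by
    rw [← mul_add]
    gcongr
    linarith [neg_abs_le (J s₀ - y s₀ ^ 2)]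
  have h4 : J 0 ≤ y 0 ^ 2 + |J 0 - y 0 ^ 2| := by linarith [le_abs_self (J 0 - y 0 ^ 2)]
  set D₀ := Real.exp (ν * t) + L ^ 3 with hD₀
  have hD₀1 : 1 ≤ D₀ := by linarith [pow_nonneg hL 3]
  have hsum : (A ^ 3 / ν * Real.exp (ν * s₀) - L ^ 3 / γ * Real.exp (-γ * s₀))
      - (A ^ 3 / ν - L ^ 3 / γ) + (A ^ 3 * Real.exp (ν * s₀) + L ^ 3 * Real.exp (-γ * s₀))
      + (A ^ 3 + L ^ 3) ≤ (A ^ 3 / ν + 1 / γ + 2 * A ^ 3 + 2) * D₀ := by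
    have e1 : A ^ 3 / ν * Real.exp (ν * s₀) ≤ A ^ 3 / ν * D₀ := by
      gcongr
      linarith [pow_nonneg hL 3]
    have e2 : 0 ≤ L ^ 3 / γ * Real.exp (-γ * s₀) := by positivity
    have e3 : 0 ≤ A ^ 3 / ν := by positivity
    have e4 : L ^ 3 / γ ≤ 1 / γ * D₀ := by
      rw [div_eq_inv_mul, one_div]
      gcongr
      linarith
    have e5 : A ^ 3 * Real.exp (ν * s₀) ≤ A ^ 3 * D₀ := by
      gcongr
      linarith [pow_nonneg hL 3]
    have e6 : L ^ 3 * Real.exp (-γ * s₀) ≤ D₀ := by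
      nlinarith [pow_nonneg hL 3]
    have e7 : A ^ 3 ≤ A ^ 3 * D₀ := by
      apply le_mul_of_one_le_right (by positivity)
      linarith [pow_nonneg hL 3]
    linarith
  have h5 := mul_le_mul_of_nonneg_left hsum hN
  linarith

/-- Boundedness of the top-order norm from a family of almost-dissipative energy estimates. -/
lemma exists_le_of_energy_estimate {k : ℕ} (hk : 1 ≤ k) {γ A C : ℝ} (hγ : 0 < γ) (hA : 1 ≤ A)
    (hC : 0 ≤ C) :
    ∃ C', 0 < C' ∧ ∀ (y J J' : ℝ → ℝ) (L : ℝ), Continuous y → (∀ s, 0 ≤ y s) → Continuous J →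
      0 ≤ L → (∀ s, 0 < s → HasDerivAt J (J' s) s) →
      (∀ s, 0 ≤ s → ∀ ρ, A + Real.exp (-γ * s) * L ≤ ρ →
        y s ≤ (A + Real.exp (-γ * s) * L) * ρ ^ (2 * k) →
        |J s - y s ^ 2| ≤ C * ((A + Real.exp (-γ * s) * L) ^ 3 * ρ ^ (4 * k - 1)) ∧
        J' s ≤ -2 * γ * J s + C * ((A + Real.exp (-γ * s) * L) ^ 3 * ρ ^ (4 * k - 1))) →
      ∀ t, 0 ≤ t → y t ≤ C' * (Real.exp (-γ * t) * (y 0 + L ^ (6 * k)) + 1) := by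
  have hkR : (1:ℝ) ≤ k := by exact_mod_cast hk
  set ν : ℝ := γ / (2 * k) with hν
  have hν0 : 0 < ν := by positivity
  have hνk : ν * (2 * k) = γ := by rw [hν]; field_simp
  have hνγ : ν ≤ γ := by nlinarith
  set Ct : ℝ := 4 * C * (A ^ 3 / ν + 1 / γ + 2 * A ^ 3 + 2) with hCt
  have hA0 : 0 ≤ A := by linarith
  have hCt0 : 0 ≤ Ct := by positivity
  set K : ℝ := A + 1 + 2 * Ct with hK
  have hK0 : 0 < K := by positivity
  refine ⟨2 + (2 * K) ^ (2 * k), by positivity,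
    fun y J J' L hy hy0 hJ hL hJ' hE t ht => ?_⟩
  obtain ⟨s₀, hs₀, hmax⟩ := exists_max_exp_mul hy γ ht
  set S := Real.exp (γ * s₀) * y s₀ with hS
  have hS0 : 0 ≤ S := mul_nonneg (Real.exp_nonneg _) (hy0 _)
  set D₀ : ℝ := Real.exp (ν * t) + L ^ 3 with hD₀
  have hD₀0 : 0 < D₀ := by positivity
  have hlarge : ∀ n : ℝ, K * D₀ ≤ n → S ≤ n ^ (2 * k) →
      S ^ 2 ≤ y 0 ^ 2 + Ct * (n ^ (4 * k - 1) * D₀) := fun n hn hSn => by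
    have hn0 : 0 ≤ n := (by positivity : 0 ≤ K * D₀).trans hn
    have hest : ∀ s ∈ Set.Icc 0 t, Real.exp (2 * γ * s) * |J s - y s ^ 2| ≤
          4 * C * n ^ (4 * k - 1) * (A ^ 3 * Real.exp (ν * s) + L ^ 3 * Real.exp (-γ * s)) ∧
        Real.exp (2 * γ * s) * (J' s + 2 * γ * J s) ≤
          4 * C * n ^ (4 * k - 1) * (A ^ 3 * Real.exp (ν * s) + L ^ 3 * Real.exp (-γ * s)) := by
      intro s hs
      have hl1 : 1 ≤ A + Real.exp (-γ * s) * L := by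
        have : 0 ≤ Real.exp (-γ * s) * L := by positivity
        linarith
      have hlρ : A + Real.exp (-γ * s) * L ≤ n * Real.exp (-ν * s) :=
        (add_exp_mul_le (K := K) hνγ hν0.le hA (by linarith) hL hs).trans (by gcongr)
      have hpow : (n * Real.exp (-ν * s)) ^ (2 * k) = n ^ (2 * k) * Real.exp (-γ * s) := by
        rw [mul_pow, ← Real.exp_nat_mul]
        congr 2
        push_cast
        rw [← hνk]
        ring
      have hinv : Real.exp (-γ * s) * Real.exp (γ * s) = 1 := by
        rw [← Real.exp_add]; simp
      have hyρ : y s ≤ (A + Real.exp (-γ * s) * L) * (n * Real.exp (-ν * s)) ^ (2 * k) := by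
        rw [hpow]
        calc y s = Real.exp (-γ * s) * (Real.exp (γ * s) * y s) := by
              rw [← mul_assoc, hinv, one_mul]
          _ ≤ Real.exp (-γ * s) * n ^ (2 * k) := by
              gcongr
              exact (hmax s hs).trans hSn
          _ = 1 * (n ^ (2 * k) * Real.exp (-γ * s)) := by ring
          _ ≤ _ := by gcongr
      have herr := exp_mul_error_le hk hνk hνγ hγ.le hA0 hC hL hn0 hs.1
      obtain ⟨h1, h2⟩ := hE s hs.1 _ hlρ hyρ
      refine ⟨(mul_le_mul_of_nonneg_left h1 (Real.exp_nonneg _)).trans herr,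
        (mul_le_mul_of_nonneg_left ?_ (Real.exp_nonneg _)).trans herr⟩
      linarith
    have hsq : S ^ 2 = Real.exp (2 * γ * s₀) * y s₀ ^ 2 := by
      rw [hS, mul_pow, ← Real.exp_nat_mul]
      ring_nf
    rw [hsq, hCt]
    refine (exp_mul_sq_le_of_energy_estimate hγ hν0 hA0 hL (by positivity) hJ hJ' hest
      hs₀).trans_eq ?_
    ring
  have hSbound : S ≤ 2 * y 0 + (K * D₀) ^ (2 * k) := by
    have hpow0 : 0 ≤ (K * D₀) ^ (2 * k) := by positivity
    rcases le_or_gt S ((K * D₀) ^ (2 * k)) with h | h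
    · linarith [hy0 0]
    · set n := S ^ (((2 * k : ℕ) : ℝ)⁻¹) with hn_def
      have hn0 : 0 ≤ n := Real.rpow_nonneg hS0 _
      have hn : n ^ (2 * k) = S := Real.rpow_inv_natCast_pow hS0 (by omega)
      have hKn : K * D₀ ≤ n := by
        rw [← hn] at h
        exact (lt_of_pow_lt_pow_left₀ _ hn0 h).le
      have h1 := hlarge n hKn hn.ge
      have h2 : Ct * (n ^ (4 * k - 1) * D₀) ≤ S ^ 2 / 2 := by
        have h3 : n ^ (4 * k - 1) * n = S ^ 2 := by
          rw [pow_sub_one_mul (by omega), ← hn, ← pow_mul]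
          ring_nf
        have h4 : 2 * Ct * D₀ ≤ n := by
          refine le_trans ?_ hKn
          gcongr
          linarith
        calc Ct * (n ^ (4 * k - 1) * D₀) = n ^ (4 * k - 1) * (2 * Ct * D₀) / 2 := by ring
          _ ≤ n ^ (4 * k - 1) * n / 2 := by gcongr
          _ = _ := by rw [h3]
      have h3 : S ≤ 2 * y 0 := by
        refine (le_abs_self S).trans (abs_le_of_sq_le_sq ?_ (by linarith [hy0 0]))
        nlinarith [sq_nonneg (y 0)]
      linarith
  have hD₀pow : (K * D₀) ^ (2 * k) ≤ (2 * K) ^ (2 * k) * (Real.exp (γ * t) + L ^ (6 * k)) := by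
    have h1 : D₀ ^ (2 * k) ≤ 2 ^ (2 * k) * (Real.exp (γ * t) + L ^ (6 * k)) := by
      refine (add_pow_le (Real.exp_nonneg _) (pow_nonneg hL 3) (2 * k)).trans ?_
      rw [← Real.exp_nat_mul, ← pow_mul]
      have e1 : ((2 * k : ℕ) : ℝ) * (ν * t) = γ * t := by
        push_cast
        rw [← hνk]
        ring
      rw [e1, show 3 * (2 * k) = 6 * k by ring]
      gcongr
      · norm_num
      · omega
    rw [mul_pow, mul_pow]
    calc K ^ (2 * k) * D₀ ^ (2 * k)
        ≤ K ^ (2 * k) * (2 ^ (2 * k) * (Real.exp (γ * t) + L ^ (6 * k))) := by gcongr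
      _ = _ := by ring
  have hinv : Real.exp (-γ * t) * Real.exp (γ * t) = 1 := by
    rw [← Real.exp_add]; simp
  set q := (2 * K) ^ (2 * k)
  have hq : 0 ≤ q := by positivity
  calc y t = Real.exp (-γ * t) * (Real.exp (γ * t) * y t) := by rw [← mul_assoc, hinv, one_mul]
    _ ≤ Real.exp (-γ * t) * (2 * y 0 + q * (Real.exp (γ * t) + L ^ (6 * k))) := by
      gcongr
      exact (hmax t ⟨ht, le_rfl⟩).trans (hSbound.trans (by linarith))
    _ = Real.exp (-γ * t) * (2 * y 0 + q * L ^ (6 * k))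
        + q * (Real.exp (-γ * t) * Real.exp (γ * t)) := by ring
    _ ≤ (2 + q) * (Real.exp (-γ * t) * (y 0 + L ^ (6 * k)) + 1) := by
      rw [hinv]
      have e1 : 0 ≤ Real.exp (-γ * t) * L ^ (6 * k) := by positivity
      have e2 : 0 ≤ q * (Real.exp (-γ * t) * y 0) :=
        mul_nonneg hq (mul_nonneg (Real.exp_nonneg _) (hy0 0))
      linarith

end Bootstrap

section EnergyEstimate

lemma abs_integral_sub_le {F G H : ℝ → ℝ} (hF : Continuous F) (hG : Continuous G)
    (hH : Continuous H) (h : ∀ x ∈ Set.Icc 0 (2 * Real.pi), |F x - G x| ≤ H x) :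
    |(∫ x in (0:ℝ)..(2 * Real.pi), F x) - ∫ x in (0:ℝ)..(2 * Real.pi), G x| ≤
      ∫ x in (0:ℝ)..(2 * Real.pi), H x := by
  rw [← intervalIntegral.integral_sub (hF.intervalIntegrable _ _) (hG.intervalIntegrable _ _)]
  exact (intervalIntegral.abs_integral_le_integral_abs (by positivity)).trans
    (intervalIntegral.integral_mono_on (by positivity)
      ((hF.sub hG).abs.intervalIntegrable _ _) (hH.intervalIntegrable _ _) h)

namespace IsDampedKdVSol

lemma continuous_Hnorm {γ : ℝ} {f : ℝ → ℝ} {u : ℝ → ℝ → ℝ} (hu : IsDampedKdVSol γ f u) (k : ℕ) :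
    Continuous fun s => Hnorm k (u s) := by
  have h : Continuous fun s => ∫ x in (0:ℝ)..(2 * Real.pi),
      ((dX^[k] hu.toPeriodic ^ 2 : periodicFunctions) : ℝ × ℝ → ℝ) (s, x) :=
    continuous_iff_continuousAt.2 fun s => (hasDerivAt_integral _ s).continuousAt
  refine h.sqrt.congr fun s => ?_
  change Real.sqrt (∫ x in (0:ℝ)..(2 * Real.pi),
    (dX^[k] hu.toPeriodic : ℝ × ℝ → ℝ) (s, x) ^ 2) = _
  simp only [hu.iterate_dX_toPeriodic]
  rfl

lemma L2norm_le {γ : ℝ} {f : ℝ → ℝ} {u : ℝ → ℝ → ℝ} (hu : IsDampedKdVSol γ f u) (hγ : 0 < γ)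
    (hf : SmoothMeanZeroPeriodic f) {m : ℝ} (hm : L2norm f ≤ m) {t : ℝ} (ht : 0 ≤ t) :
    L2norm (u t) ≤ Real.exp (-γ * t) * L2norm (u 0) + 2 * m / γ := by
  refine le_of_deriv_sq_le (y := fun s => L2norm (u s)) hγ ((L2norm_nonneg f).trans hm)
    (by simpa [Hnorm] using hu.continuous_Hnorm 0) (fun _ => L2norm_nonneg _)
    (fun s hs => hu.hasDerivAt_sq_L2norm hf hs) (fun s hs => ?_) ht
  have h := (le_abs_self _).trans (abs_integral_mul_le (hu.2.1 s hs.le).continuous hf.continuous)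
  have := mul_le_mul_of_nonneg_left hm (L2norm_nonneg (u s))
  linarith

/-- The energy density and its production rate, with pointwise error bounds. -/
lemma exists_pointwise_energy {k : ℕ} (hk : 1 ≤ k) {γ M : ℝ} (hγ : 0 < γ) (hM : 0 < M) :
    ∃ C, 0 ≤ C ∧ ∀ f, SmoothMeanZeroPeriodic f → Hnorm k f ≤ M →
      ∀ u, IsDampedKdVSol γ f u → ∃ E E' q : periodicFunctions, dT E = E' + dX q ∧
        ∀ t, 0 ≤ t → ∀ l ρ, 1 ≤ l → l ≤ ρ → L2norm (u t) ≤ l → Hnorm k (u t) ≤ l * ρ ^ (2 * k) →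
          ∀ x ∈ Set.Icc 0 (2 * Real.pi),
          |(E : ℝ × ℝ → ℝ) (t, x) - iteratedDeriv k (u t) x ^ 2| ≤
            C * (|iteratedDeriv k (u t) x| * ((l / ρ ^ 3) ^ 2 * (ρ ^ 2) ^ (k + 2))
              + (l / ρ ^ 3) ^ 3 * (ρ ^ 2) ^ (2 * k + 4)) ∧
          |(E' : ℝ × ℝ → ℝ) (t, x) - 2 * (iteratedDeriv k (u t) x *
              (iteratedDeriv k f x - γ * iteratedDeriv k (u t) x))| ≤
            C * ((|iteratedDeriv k (u t) x| +
              |iteratedDeriv k f x - γ * iteratedDeriv k (u t) x|)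
              * ((l / ρ ^ 3) ^ 2 * (ρ ^ 2) ^ (k + 2))
              + (l / ρ ^ 3) ^ 3 * (ρ ^ 2) ^ (2 * k + 4)) := by
  obtain ⟨P, hP, Q, hPQ⟩ := exists_gardner_normal_form k hk
  set c : ℝ := 2 * ((4 * Real.pi) ^ k * M) with hc
  have hc0 : 0 ≤ c := by positivity
  obtain ⟨C, hC, hbound⟩ := exists_abs_energy_sub_le hP (2 * (1 + γ) + c)
  refine ⟨C, hC, fun f hf hfM u hu => ?_⟩
  obtain ⟨W, hW0, hW, hT⟩ := exists_dual_densities dX dT (directional_comm _ _) hu.toPeriodic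
  obtain ⟨q, hq⟩ := exists_energy_balance (directional_comm _ _) hW hT hPQ
  refine ⟨_, _, q, hq, fun t ht l ρ hl hlρ hL hH x hx => ?_⟩
  have hl0 : 0 < l := by linarith
  have hρ0 : 0 < ρ := by linarith
  have hρ1 : 1 ≤ ρ := by linarith
  have hδ : l / ρ ^ 3 ≤ 1 :=
    (div_le_one (by positivity)).2 (hlρ.trans (le_self_pow₀ hρ1 (by norm_num)))
  have hiter : ∀ i, MvPolynomial.aeval (fun n => dualEval (pointEval (t, x)) (W n))
      (gardnerD^[i] (MvPolynomial.X 0)) = TrivSqZeroExt.inl (iteratedDeriv i (u t) x)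
        + TrivSqZeroExt.inr (iteratedDeriv i f x - γ * iteratedDeriv i (u t) x) := fun i => by
    rw [aeval_dualEval, aeval_gardnerD_iterate _ hW, hW0, iterate_dualDerivation,
      ← hu.iterate_dX_kdvDefect hf ht, ← hu.iterate_dX_toPeriodic]
    ext <;> simp [dualEval, pointEval_apply, kdvDefect]
  have h := hbound _ (l / ρ ^ 3) (ρ ^ 2) _ _ (by positivity) hδ (by positivity)
    (fun i hi => ?_) (hiter k)
  · rw [aeval_dualEval] at h
    have e : dualEval (pointEval (t, x)) (W k) ^ 2
        + dualEval (pointEval (t, x)) (MvPolynomial.aeval W P)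
        = dualEval (pointEval (t, x)) (W k ^ 2 + MvPolynomial.aeval W P) := by
      have := aeval_dualEval (pointEval (t, x)) W (MvPolynomial.X k ^ 2 + P)
      rwa [map_add, map_pow, MvPolynomial.aeval_X, map_add, map_pow, MvPolynomial.aeval_X,
        aeval_dualEval] at this
    rw [e] at h
    simpa [dualEval, pointEval_apply] using h
  · rw [hiter, TrivSqZeroExt.norm_def]
    have h1 := (hu.2.1 t ht).abs_iteratedDeriv_le hl0 hρ0 hL hH hi hx
    have h2 := hf.abs_iteratedDeriv_le_of_Hnorm_le hfM hi hx
    rw [← hc] at h2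
    have h3 : (2 * (1 + γ) + c) * (l / ρ ^ 3) * (ρ ^ 2) ^ (i + 2)
        = (2 * (1 + γ) + c) * (l * ρ ^ (2 * i + 1)) := by
      rw [← pow_mul, show 2 * (i + 2) = 2 * i + 1 + 3 by ring, pow_add ρ (2 * i + 1) 3]
      field_simp
    have h4 : 1 ≤ l * ρ ^ (2 * i + 1) := one_le_mul_of_one_le_of_one_le hl (one_le_pow₀ hρ1)
    have h5 := abs_sub (iteratedDeriv i f x) (γ * iteratedDeriv i (u t) x)
    rw [abs_mul, abs_of_pos hγ] at h5
    have h6 := mul_le_mul_of_nonneg_left h1 hγ.le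
    have h7 := le_mul_of_one_le_right hc0 h4
    rw [h3]
    simp only [TrivSqZeroExt.fst_add, TrivSqZeroExt.fst_inl, TrivSqZeroExt.fst_inr, add_zero,
      TrivSqZeroExt.snd_add, TrivSqZeroExt.snd_inl, TrivSqZeroExt.snd_inr, zero_add,
      Real.norm_eq_abs]
    linarith

/-- The modified energy controls the `H^k` norm and almost satisfies the damped energy law. -/
lemma exists_energy {k : ℕ} (hk : 1 ≤ k) {γ M : ℝ} (hγ : 0 < γ) (hM : 0 < M) :
    ∃ C, 0 ≤ C ∧ ∀ f, SmoothMeanZeroPeriodic f → Hnorm k f ≤ M →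
      ∀ u, IsDampedKdVSol γ f u → ∃ J J' : ℝ → ℝ, Continuous J ∧
        (∀ t, 0 < t → HasDerivAt J (J' t) t) ∧
        ∀ t, 0 ≤ t → ∀ l ρ, 1 ≤ l → l ≤ ρ → L2norm (u t) ≤ l → Hnorm k (u t) ≤ l * ρ ^ (2 * k) →
          |J t - Hnorm k (u t) ^ 2| ≤ C * (l ^ 3 * ρ ^ (4 * k - 1)) ∧
          J' t ≤ -2 * γ * J t + C * (l ^ 3 * ρ ^ (4 * k - 1)) := by
  obtain ⟨C, hC, hmain⟩ := exists_pointwise_energy hk hγ hM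
  set s := Real.sqrt (2 * Real.pi) with hs
  have hs0 : 0 ≤ s := Real.sqrt_nonneg _
  have hpi := Real.pi_pos
  set C₁ := C * (s + 2 * Real.pi) with hC₁
  set C₂ := C * (s * (1 + γ + M) + 2 * Real.pi) with hC₂
  have hC₁0 : 0 ≤ C₁ := by positivity
  have hC₂0 : 0 ≤ C₂ := by positivity
  refine ⟨C₁ + C₂ + 2 * M + 2 * γ * C₁, by positivity, fun f hf hfM u hu => ?_⟩
  obtain ⟨E, E', q, hq, hpt⟩ := hmain f hf hfM u hu
  refine ⟨fun t => ∫ x in (0:ℝ)..(2 * Real.pi), (E : ℝ × ℝ → ℝ) (t, x),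
    fun t => ∫ x in (0:ℝ)..(2 * Real.pi), (E' : ℝ × ℝ → ℝ) (t, x),
    continuous_iff_continuousAt.2 fun s => (hasDerivAt_integral _ s).continuousAt,
    fun t ht => hasDerivAt_integral_of_balance hq ht, fun t ht l ρ hl hlρ hL hH => ?_⟩
  have hx := hpt t ht l ρ hl hlρ hL hH
  have hl0 : 0 < l := by linarith
  have hρ0 : 0 < ρ := by linarith
  have hρ1 : 1 ≤ ρ := by linarith
  set e := (l / ρ ^ 3) ^ 2 * (ρ ^ 2) ^ (k + 2) with he
  have he0 : 0 ≤ e := by positivity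
  set y := Hnorm k (u t) with hy
  have hy0 : 0 ≤ y := L2norm_nonneg _
  set z := l ^ 3 * ρ ^ (4 * k - 1) with hz
  have hz0 : 0 ≤ z := by positivity
  have hz' : (l / ρ ^ 3) ^ 3 * (ρ ^ 2) ^ (2 * k + 4) = z := by
    obtain ⟨m, rfl⟩ := Nat.exists_eq_add_of_le hk
    rw [hz, show 4 * (1 + m) - 1 = 4 * m + 3 by omega]
    field_simp
    ring
  have hez : e * (l * ρ ^ (2 * k)) ≤ z := by
    have h1 : e * (l * ρ ^ (2 * k)) * ρ = z := by
      obtain ⟨m, rfl⟩ := Nat.exists_eq_add_of_le hk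
      rw [he, hz, show 4 * (1 + m) - 1 = 4 * m + 3 by omega]
      field_simp
      ring
    rw [← h1]
    exact le_mul_of_one_le_right (by positivity) hρ1
  have hl1 : 1 ≤ l * ρ ^ (2 * k) := one_le_mul_of_one_le_of_one_le hl (one_le_pow₀ hρ1)
  have hez1 : e ≤ z := (le_mul_of_one_le_right he0 hl1).trans hez
  have hey : e * y ≤ z := (mul_le_mul_of_nonneg_left hH he0).trans hez
  have hyz : y ≤ z := by
    refine hH.trans ?_
    rw [hz]
    gcongr
    · exact le_self_pow₀ hl (by norm_num)
    · omega
  have hcu := ((hu.2.1 t ht).iteratedDeriv k).continuous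
  have hcf := (hf.iteratedDeriv k).continuous
  have hcE := continuous_slice E t
  have hcE' := continuous_slice E' t
  rw [hz'] at hx
  set a := iteratedDeriv k (u t) with ha
  set F := iteratedDeriv k f with hF
  have hIa : ∫ x in (0:ℝ)..(2 * Real.pi), |a x| ≤ s * y := integral_abs_le hcu
  have hIF : ∫ x in (0:ℝ)..(2 * Real.pi), |F x| ≤ s * M :=
    (integral_abs_le hcf).trans (mul_le_mul_of_nonneg_left hfM hs0)
  have hJ : |(∫ x in (0:ℝ)..(2 * Real.pi), (E : ℝ × ℝ → ℝ) (t, x)) - y ^ 2| ≤ C₁ * z := by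
    rw [hy, Hnorm, sq_L2norm]
    refine (abs_integral_sub_le hcE (hcu.pow 2) (H := fun x => C * (|a x| * e + z))
      (by fun_prop) fun x hx' => (hx x hx').1).trans ?_
    rw [intervalIntegral.integral_const_mul,
      intervalIntegral.integral_add (Continuous.intervalIntegrable (by fun_prop) _ _) (by simp),
      intervalIntegral.integral_mul_const, intervalIntegral.integral_const, smul_eq_mul, sub_zero,
      hC₁, mul_assoc C]
    refine mul_le_mul_of_nonneg_left ?_ hC
    have h1 := mul_le_mul_of_nonneg_right hIa he0
    have h2 := mul_le_mul_of_nonneg_left hey hs0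
    linarith
  have hJ' : |(∫ x in (0:ℝ)..(2 * Real.pi), (E' : ℝ × ℝ → ℝ) (t, x)) -
      ∫ x in (0:ℝ)..(2 * Real.pi), 2 * (a x * (F x - γ * a x))| ≤ C₂ * z := by
    refine (abs_integral_sub_le hcE' (by fun_prop)
      (H := fun x => C * (((1 + γ) * |a x| + |F x|) * e + z))
      (by fun_prop) fun x hx' => (hx x hx').2.trans ?_).trans ?_
    · have h5 := abs_sub (F x) (γ * a x)
      rw [abs_mul, abs_of_pos hγ] at h5
      have h6 : |a x| + |F x - γ * a x| ≤ (1 + γ) * |a x| + |F x| := by linarith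
      have h7 := mul_le_mul_of_nonneg_right h6 he0
      exact mul_le_mul_of_nonneg_left (by linarith) hC
    · rw [intervalIntegral.integral_const_mul,
        intervalIntegral.integral_add (Continuous.intervalIntegrable (by fun_prop) _ _) (by simp),
        intervalIntegral.integral_mul_const,
        intervalIntegral.integral_add (Continuous.intervalIntegrable (by fun_prop) _ _)
          (Continuous.intervalIntegrable (by fun_prop) _ _),
        intervalIntegral.integral_const_mul, intervalIntegral.integral_const, smul_eq_mul,
        sub_zero, hC₂, mul_assoc C]
      refine mul_le_mul_of_nonneg_left ?_ hC
      have h1 : (1 + γ) * (∫ x in (0:ℝ)..(2 * Real.pi), |a x|)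
          + (∫ x in (0:ℝ)..(2 * Real.pi), |F x|) ≤ (1 + γ) * (s * y) + s * M := by gcongr
      have h2 := mul_le_mul_of_nonneg_right h1 he0
      have h3 := mul_le_mul_of_nonneg_left hey (by positivity : 0 ≤ (1 + γ) * s)
      have h4 := mul_le_mul_of_nonneg_left hez1 (by positivity : 0 ≤ s * M)
      linarith
  have hprod : ∫ x in (0:ℝ)..(2 * Real.pi), 2 * (a x * (F x - γ * a x)) ≤
      2 * M * z - 2 * γ * y ^ 2 := by
    have e1 : ∀ x, 2 * (a x * (F x - γ * a x)) = 2 * (a x * F x) - (2 * γ) * a x ^ 2 :=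
      fun x => by ring
    simp only [e1]
    rw [intervalIntegral.integral_sub (Continuous.intervalIntegrable (by fun_prop) _ _)
      (Continuous.intervalIntegrable (by fun_prop) _ _), intervalIntegral.integral_const_mul,
      intervalIntegral.integral_const_mul, hy, Hnorm, sq_L2norm]
    have h1 := (le_abs_self _).trans (abs_integral_mul_le hcu hcf)
    have h2 : L2norm a * L2norm F ≤ z * M := mul_le_mul hyz hfM (L2norm_nonneg _) hz0
    linarith
  have h1 := abs_le.1 hJ
  have h2 := abs_le.1 hJ'
  have p1 : 0 ≤ C₁ * z := by positivity
  have p2 : 0 ≤ C₂ * z := by positivity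
  have p3 : 0 ≤ M * z := by positivity
  have p4 : 0 ≤ γ * (C₁ * z) := by positivity
  have h3 := mul_le_mul_of_nonneg_left h1.2 hγ.le
  constructor
  · refine hJ.trans ?_
    linarith
  · linarith

end IsDampedKdVSol

end EnergyEstimate

/-- Lyapunov-type `H^k` bound, with exponential decay of the data. -/
theorem lyapunov_Hk_bound (k : ℕ) (γ : ℝ) (hγ : 0 < γ) :
    ∃ q : ℝ, 0 < q ∧
      ∀ M : ℝ, 0 < M → ∃ C : ℝ, 0 < C ∧
        ∀ f : ℝ → ℝ, SmoothMeanZeroPeriodic f → Hnorm k f ≤ M →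
          ∀ u : ℝ → ℝ → ℝ, IsDampedKdVSol γ f u →
            ∀ t : ℝ, 0 ≤ t →
              Hnorm k (u t)
                ≤ C * (Real.exp (-γ * t) * (Hnorm k (u 0) + (L2norm (u 0)) ^ q) + 1) := by
  rcases Nat.eq_zero_or_pos k with rfl | hk
  · refine ⟨1, one_pos, fun M hM => ⟨1 + 2 * M / γ, by positivity, fun f hf hfM u hu t ht => ?_⟩⟩
    simp only [Hnorm, iteratedDeriv_zero, Real.rpow_one] at hfM ⊢
    have h := hu.L2norm_le hγ hf hfM ht
    have h0 : 0 ≤ Real.exp (-γ * t) * L2norm (u 0) :=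
      mul_nonneg (Real.exp_nonneg _) (L2norm_nonneg _)
    have h1 : 0 ≤ 2 * M / γ := by positivity
    nlinarith [mul_nonneg h1 h0]
  · refine ⟨(6 * k : ℕ), by positivity, fun M hM => ?_⟩
    obtain ⟨C, hC, hE⟩ := IsDampedKdVSol.exists_energy hk hγ hM
    set m := (4 * Real.pi) ^ k * M with hm
    have hm0 : 0 ≤ 2 * m / γ := by positivity
    obtain ⟨C', hC', hB⟩ := exists_le_of_energy_estimate hk hγ
      (by linarith : 1 ≤ 1 + 2 * m / γ) hC
    refine ⟨C', hC', fun f hf hfM u hu t ht => ?_⟩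
    obtain ⟨J, J', hJ, hJ', hest⟩ := hE f hf hfM u hu
    have hfm : L2norm f ≤ m := by
      have h := hf.Hnorm_le hk.le
      rw [Hnorm, iteratedDeriv_zero] at h
      exact h.trans (mul_le_mul_of_nonneg_left hfM (by positivity))
    rw [Real.rpow_natCast]
    refine hB (fun s => Hnorm k (u s)) J J' (L2norm (u 0)) (hu.continuous_Hnorm k)
      (fun _ => L2norm_nonneg _) hJ (L2norm_nonneg _) hJ' (fun s hs ρ hρ hy => ?_) t ht
    have h0 : 0 ≤ Real.exp (-γ * s) * L2norm (u 0) :=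
      mul_nonneg (Real.exp_nonneg _) (L2norm_nonneg _)
    refine hest s hs _ ρ (by linarith) hρ ?_ hy
    linarith [hu.L2norm_le hγ hf hfm hs]
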